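/- Let X be a conjugacy class of involutions in G_n with labelled cycle type (m,0,0,l), i.e. k_e = k_o = 0. If 2m = n, then Diam C(G_n,X) ≤ 3. If n ≥ 5 and l ≥ 2, then Diam C(G_n,X) ≤ 5. -/

import Mathlib

/-!
Common setup: the affine Weyl group of type C̃ₙ, realized as the semidirect
product of the group Wₙ of signed permutations of {1,…,n} with the translation
lattice ℤⁿ.  An element is a triple `(π, s, v)`, where `π` is the underlying
permutation of the n points, `s i` is the sign attached to the point `i`
(so the signed permutation maps the point `i` to the point `π i` with sign `s i`),
and `v ∈ ℤⁿ` is the translation part.  The multiplication realizes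
`(α,v)(τ,u) = (ατ, vᵗ + u)`.
-/

/-- An element of the affine Weyl group of type C̃ₙ: a signed permutation
`(π, s)` together with a translation vector `v ∈ ℤⁿ`. -/
@[ext]
structure AffineWeylC (n : ℕ) where
  π : Equiv.Perm (Fin n)
  s : Fin n → ℤˣ
  v : Fin n → ℤ

namespace AffineWeylC

variable {n : ℕ}

instance : One (AffineWeylC n) := ⟨⟨1, 1, 0⟩⟩

instance : Mul (AffineWeylC n) :=
  ⟨fun g h => ⟨h.π * g.π, fun j => g.s j * h.s (g.π j),
    fun i => (h.s (h.π⁻¹ i) : ℤ) * g.v (h.π⁻¹ i) + h.v i⟩⟩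

instance : Inv (AffineWeylC n) :=
  ⟨fun g => ⟨g.π⁻¹, fun k => (g.s (g.π⁻¹ k))⁻¹,
    fun i => -(((g.s i)⁻¹ : ℤˣ) : ℤ) * g.v (g.π i)⟩⟩

@[simp] lemma mul_π (g h : AffineWeylC n) : (g * h).π = h.π * g.π := rfl
@[simp] lemma mul_s (g h : AffineWeylC n) (j : Fin n) :
    (g * h).s j = g.s j * h.s (g.π j) := rfl
@[simp] lemma mul_v (g h : AffineWeylC n) (i : Fin n) :
    (g * h).v i = (h.s (h.π⁻¹ i) : ℤ) * g.v (h.π⁻¹ i) + h.v i := rfl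
@[simp] lemma one_π : (1 : AffineWeylC n).π = 1 := rfl
@[simp] lemma one_s (j : Fin n) : (1 : AffineWeylC n).s j = 1 := rfl
@[simp] lemma one_v (i : Fin n) : (1 : AffineWeylC n).v i = 0 := rfl
@[simp] lemma inv_π (g : AffineWeylC n) : g⁻¹.π = g.π⁻¹ := rfl
@[simp] lemma inv_s (g : AffineWeylC n) (k : Fin n) :
    g⁻¹.s k = (g.s (g.π⁻¹ k))⁻¹ := rfl
@[simp] lemma inv_v (g : AffineWeylC n) (i : Fin n) :
    g⁻¹.v i = -(((g.s i)⁻¹ : ℤˣ) : ℤ) * g.v (g.π i) := rfl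

instance : Group (AffineWeylC n) where
  mul_assoc a b c := by
    refine AffineWeylC.ext ?_ (funext fun j => ?_) (funext fun i => ?_)
    · simp [mul_assoc]
    · simp only [mul_s, mul_π, Equiv.Perm.mul_apply]
      rw [mul_assoc]
    · simp only [mul_v, mul_s, mul_π, mul_inv_rev, Equiv.Perm.mul_apply,
        show ∀ (f : Equiv.Perm (Fin n)) (x : Fin n), f (f⁻¹ x) = x from fun f => f.apply_symm_apply,
        Units.val_mul]
      ring
  one_mul a := by
    refine AffineWeylC.ext ?_ (funext fun j => ?_) (funext fun i => ?_) <;>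
      simp
  mul_one a := by
    refine AffineWeylC.ext ?_ (funext fun j => ?_) (funext fun i => ?_) <;>
      simp
  inv_mul_cancel a := by
    refine AffineWeylC.ext ?_ (funext fun j => ?_) (funext fun i => ?_)
    · simp
    · simp
    · simp only [mul_v, inv_v, inv_s, one_v,
        show ∀ (f : Equiv.Perm (Fin n)) (x : Fin n), f (f⁻¹ x) = x from fun f => f.apply_symm_apply]
      have h1 : ((a.s (a.π⁻¹ i) : ℤ)) * (((a.s (a.π⁻¹ i))⁻¹ : ℤˣ) : ℤ) = 1 := by
        rw [← Units.val_mul, mul_inv_cancel, Units.val_one]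
      linear_combination (-(a.v i)) * h1

/-- `g` is an involution: a non-identity element squaring to the identity. -/
def Involution (g : AffineWeylC n) : Prop := g ≠ 1 ∧ g * g = 1

/-- The conjugacy class of `a`. -/
def conjClass (a : AffineWeylC n) : Set (AffineWeylC n) := {b | IsConj a b}

/-- The number of transpositions (2-cycles) of the underlying signed permutation. -/
noncomputable def numTrans (g : AffineWeylC n) : ℕ :=
  {i : Fin n | g.π i ≠ i}.ncard / 2

/-- The number of negative 1-cycles of `g` carrying an even label. -/
noncomputable def numNegEven (g : AffineWeylC n) : ℕ :=
  {i : Fin n | g.π i = i ∧ g.s i = -1 ∧ Even (g.v i)}.ncard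

/-- The number of negative 1-cycles of `g` carrying an odd label. -/
noncomputable def numNegOdd (g : AffineWeylC n) : ℕ :=
  {i : Fin n | g.π i = i ∧ g.s i = -1 ∧ Odd (g.v i)}.ncard

/-- The number of positive 1-cycles (fixed points) of `g`. -/
noncomputable def numPos (g : AffineWeylC n) : ℕ :=
  {i : Fin n | g.π i = i ∧ g.s i = 1}.ncard

/-- The labelled cycle type `(m, k_e, k_o, l)` of an involution. -/
noncomputable def cycleType (g : AffineWeylC n) : ℕ × ℕ × ℕ × ℕ :=
  (numTrans g, numNegEven g, numNegOdd g, numPos g)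

/-- `g` has labelled cycle type `(m, k_e, k_o, l)`. -/
def HasType (g : AffineWeylC n) (m ke ko l : ℕ) : Prop :=
  numTrans g = m ∧ numNegEven g = ke ∧ numNegOdd g = ko ∧ numPos g = l

/-- The canonical class representative
`a_{m,k_e,k_o,l} = (1 2)⁺₀ ⋯ (2m−1 2m)⁺₀ (2m+1)⁻₀ ⋯ (2m+k_e)⁻₀
(2m+k_e+1)⁻₁ ⋯ (n−l)⁻₁ (n−l+1)⁺₀ ⋯ (n)⁺₀`
(here written with 0-based indices): points `0,…,2m-1` are paired off into
label‑0 positive transpositions, points `2m,…,2m+k_e-1` are negative 1-cycles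
with label 0, points `2m+k_e,…,2m+k_e+k_o-1` are negative 1-cycles with label 1,
and the remaining `l` points are positive fixed points with label 0. -/
def IsCanon (a : AffineWeylC n) (m ke ko l : ℕ) : Prop :=
  2*m + ke + ko + l = n ∧
  (∀ i : Fin n, i.val < 2*m → i.val % 2 = 0 → (a.π i).val = i.val + 1) ∧
  (∀ i : Fin n, i.val < 2*m → i.val % 2 = 1 → (a.π i).val = i.val - 1) ∧
  (∀ i : Fin n, 2*m ≤ i.val → a.π i = i) ∧
  (∀ i : Fin n, i.val < 2*m → a.s i = 1 ∧ a.v i = 0) ∧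
  (∀ i : Fin n, 2*m ≤ i.val → i.val < 2*m + ke → a.s i = -1 ∧ a.v i = 0) ∧
  (∀ i : Fin n, 2*m + ke ≤ i.val → i.val < 2*m + ke + ko → a.s i = -1 ∧ a.v i = 1) ∧
  (∀ i : Fin n, 2*m + ke + ko ≤ i.val → a.s i = 1 ∧ a.v i = 0)

/-- The labelled positive transposition `(α β)⁺_λ`. -/
def posTrans (α β : Fin n) (lam : ℤ) : AffineWeylC n :=
  ⟨Equiv.swap α β, 1, fun i => if i = α then lam else if i = β then -lam else 0⟩

/-- The labelled negative transposition `(α β)⁻_λ`. -/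
def negTrans (α β : Fin n) (lam : ℤ) : AffineWeylC n :=
  ⟨Equiv.swap α β, fun i => if i = α then -1 else if i = β then -1 else 1,
    fun i => if i = α then lam else if i = β then lam else 0⟩

/-- The labelled negative 1-cycle `(α)⁻_λ`. -/
def negOne (α : Fin n) (lam : ℤ) : AffineWeylC n :=
  ⟨1, fun i => if i = α then -1 else 1, fun i => if i = α then lam else 0⟩

/-- The finite Weyl group Wₙ of type Cₙ, as the subgroup of the affine Weyl
group consisting of the elements with trivial translation part. -/
def WeylSub (n : ℕ) : Subgroup (AffineWeylC n) where
  carrier := {g | g.v = 0}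
  one_mem' := rfl
  mul_mem' := by
    intro g h hg hh
    show (g * h).v = 0
    funext i
    simp only [mul_v]
    rw [show g.v = 0 from hg, show h.v = 0 from hh]
    simp
  inv_mem' := by
    intro g hg
    show g⁻¹.v = 0
    funext i
    simp only [inv_v]
    rw [show g.v = 0 from hg]
    simp

/-- The projection `G_n → W_n`, `(σ, v) ↦ σ`. -/
def weylPart (n : ℕ) : AffineWeylC n →* WeylSub n where
  toFun g := ⟨⟨g.π, g.s, 0⟩, rfl⟩
  map_one' := by
    apply Subtype.ext
    refine AffineWeylC.ext rfl rfl rfl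
  map_mul' g h := by
    apply Subtype.ext
    refine AffineWeylC.ext rfl rfl (funext fun i => ?_)
    simp

end AffineWeylC

/-- The commuting graph on a subset `X` of a group: the vertices are the
elements of `X`, and distinct vertices are adjacent iff they commute. -/
def commGraph {G : Type*} [Group G] (X : Set G) : SimpleGraph X where
  Adj x y := (x : G) ≠ (y : G) ∧ Commute (x : G) (y : G)
  symm := ⟨fun _ _ h => ⟨fun e => h.1 e.symm, h.2.symm⟩⟩
  loopless := ⟨fun _ h => h.1 rfl⟩

section SignedMatchings

variable {ι : Type*}

/-- The change of sign on the signed points `ι × ℤˣ`. -/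
def signFlip (ι : Type*) : Equiv.Perm (ι × ℤˣ) :=
  Function.Involutive.toPerm (fun ω => (ω.1, -ω.2)) fun ω => by simp

@[simp] lemma signFlip_apply (ω : ι × ℤˣ) : signFlip ι ω = (ω.1, -ω.2) := rfl

lemma eq_or_eq_signFlip {ω ω' : ι × ℤˣ} (h : ω.1 = ω'.1) : ω' = ω ∨ ω' = signFlip ι ω := by
  obtain ⟨i, e⟩ := ω
  obtain ⟨j, f⟩ := ω'
  obtain rfl : i = j := h
  rcases Int.units_eq_one_or e with rfl | rfl <;> rcases Int.units_eq_one_or f with rfl | rfl <;>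
    simp

/-- `x` is a signed permutation of order dividing two, moving exactly the points of `S`, and
fixing the other points with positive sign. -/
structure IsSignedMatching (x : Equiv.Perm (ι × ℤˣ)) (S : Finset ι) : Prop where
  apply_apply : ∀ ω, x (x ω) = ω
  apply_signFlip : ∀ ω, x (signFlip ι ω) = signFlip ι (x ω)
  apply_of_notMem : ∀ ω, ω.1 ∉ S → x ω = ω
  fst_ne : ∀ ω, ω.1 ∈ S → (x ω).1 ≠ ω.1

/-- The signed permutation `x` maps the signed points over `A` to themselves. -/
def Preserves (x : Equiv.Perm (ι × ℤˣ)) (A : Finset ι) : Prop :=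
  ∀ ω, (x ω).1 ∈ A ↔ ω.1 ∈ A

lemma commute_iff_apply {x y : Equiv.Perm (ι × ℤˣ)} :
    Commute x y ↔ ∀ ω, x (y ω) = y (x ω) :=
  ⟨fun h ω => congrArg (fun f : Equiv.Perm (ι × ℤˣ) => f ω) h.eq, fun h => Equiv.ext h⟩

/-- Commutation of two signed permutations can be checked on one signed point over each point. -/
lemma apply_comm_of_fst_eq {p : ι × ℤˣ} {x y : Equiv.Perm (ι × ℤˣ)} (hx : Commute x (signFlip ι))
    (hy : Commute y (signFlip ι)) {ω : ι × ℤˣ} (h : x (y p) = y (x p)) (hω : ω.1 = p.1) :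
    x (y ω) = y (x ω) := by
  rw [commute_iff_apply] at hx hy
  rcases eq_or_eq_signFlip hω.symm with rfl | rfl
  · exact h
  · rw [hy, hx, hx, hy, h]

namespace IsSignedMatching

variable {x y z : Equiv.Perm (ι × ℤˣ)} {S T K A : Finset ι}

lemma preserves_of_imp (hx : IsSignedMatching x S) (h : ∀ ω, ω.1 ∈ A → (x ω).1 ∈ A) :
    Preserves x A :=
  fun ω => ⟨fun hω => by simpa [hx.apply_apply] using h _ hω, h ω⟩

lemma preserves_support (hx : IsSignedMatching x S) : Preserves x S :=
  hx.preserves_of_imp fun ω hω => by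
    by_contra h
    have := hx.apply_of_notMem _ h
    rw [hx.apply_apply] at this
    exact hx.fst_ne ω hω (congrArg Prod.fst this.symm)

lemma fst_congr (hx : IsSignedMatching x S) {ω ω' : ι × ℤˣ} (h : ω.1 = ω'.1) :
    (x ω).1 = (x ω').1 := by
  rcases eq_or_eq_signFlip h with rfl | rfl
  · rfl
  · simp [hx.apply_signFlip, -signFlip_apply]
    rfl

lemma even_card (hx : IsSignedMatching x S) (hK : K ⊆ S) (hp : Preserves x K) :
    Even K.card := by
  rw [← ZMod.natCast_eq_zero_iff_even, Finset.card_eq_sum_ones, Nat.cast_sum]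
  refine Finset.sum_involution (fun i _ => (x (i, 1)).1) ?_ ?_ ?_ ?_
  · intro i _
    decide
  · intro i hi _
    exact hx.fst_ne (i, 1) (hK hi)
  · intro i hi
    exact (hp (i, 1)).2 hi
  · intro i hi
    have : (x ((x (i, 1)).1, 1)).1 = (x (x (i, 1))).1 := hx.fst_congr rfl
    simpa [hx.apply_apply] using this

lemma commute_of_disjoint (hx : IsSignedMatching x S) (hy : IsSignedMatching y T)
    (h : Disjoint S T) : Commute x y := by
  rw [commute_iff_apply]
  intro ω
  by_cases hS : ω.1 ∈ S
  · have hT := Finset.disjoint_left.1 h hS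
    rw [hy.apply_of_notMem ω hT, hy.apply_of_notMem]
    exact Finset.disjoint_left.1 h ((hx.preserves_support ω).2 hS)
  · rw [hx.apply_of_notMem ω hS]
    by_cases hT : ω.1 ∈ T
    · rw [hx.apply_of_notMem]
      exact Finset.disjoint_right.1 h ((hy.preserves_support ω).2 hT)
    · rw [hy.apply_of_notMem ω hT, hx.apply_of_notMem ω hS]

variable [DecidableEq ι]

lemma mul (hx : IsSignedMatching x S) (hy : IsSignedMatching y T) (h : Disjoint S T) :
    IsSignedMatching (x * y) (S ∪ T) := by
  have hc := commute_iff_apply.1 (hx.commute_of_disjoint hy h)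
  refine ⟨fun ω => ?_, fun ω => ?_, fun ω hω => ?_, fun ω hω => ?_⟩
  · simp only [Equiv.Perm.mul_apply]
    rw [← hc (y ω), hy.apply_apply, hx.apply_apply]
  · simp only [Equiv.Perm.mul_apply, hx.apply_signFlip, hy.apply_signFlip]
  · rw [Finset.mem_union, not_or] at hω
    rw [Equiv.Perm.mul_apply, hy.apply_of_notMem ω hω.2, hx.apply_of_notMem ω hω.1]
  · rw [Equiv.Perm.mul_apply]
    rcases Finset.mem_union.1 hω with hS | hT
    · rw [hy.apply_of_notMem ω (Finset.disjoint_left.1 h hS)]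
      exact hx.fst_ne ω hS
    · rw [hx.apply_of_notMem]
      · exact hy.fst_ne ω hT
      · exact Finset.disjoint_right.1 h ((hy.preserves_support ω).2 hT)

lemma exists_restrict (hx : IsSignedMatching x S) (hK : K ⊆ S) (hp : Preserves x K) :
    ∃ x', IsSignedMatching x' K ∧ ∀ ω, ω.1 ∈ K → x' ω = x ω := by
  let f : ι × ℤˣ → ι × ℤˣ := fun ω => if ω.1 ∈ K then x ω else ω
  have hf : Function.Involutive f := by
    intro ω
    by_cases h : ω.1 ∈ K
    · simp [f, h, (hp ω).2 h, hx.apply_apply]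
    · simp [f, h]
  refine ⟨hf.toPerm, ⟨hf, fun ω => ?_, fun ω hω => ?_, fun ω hω => ?_⟩, fun ω hω => ?_⟩
  · by_cases h : ω.1 ∈ K
    · have := hx.apply_signFlip ω
      simp only [signFlip_apply] at this
      simp [f, h, this]
    · simp [f, h]
  · simp [f, hω]
  · simpa [f, hω] using hx.fst_ne ω (hK hω)
  · simp [f, hω]

/-- A signed matching commutes with any signed matching preserving its support and agreeing there
with a permutation it commutes with. -/
lemma commute_of_eqOn (hz : IsSignedMatching z K) (hy : Preserves y K)
    (h : ∀ ω, ω.1 ∈ K → y ω = x ω) (hc : Commute z x) : Commute z y := by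
  rw [commute_iff_apply] at hc ⊢
  intro ω
  by_cases hω : ω.1 ∈ K
  · rw [h ω hω, h _ ((hz.preserves_support ω).2 hω), hc]
  · rw [hz.apply_of_notMem ω hω, hz.apply_of_notMem]
    rwa [hy ω]

end IsSignedMatching

section SignedSwap

variable [DecidableEq ι]

/-- The signed transposition exchanging the signed points `p` and `q`, and their negatives. -/
def signedSwap (p q : ι × ℤˣ) : Equiv.Perm (ι × ℤˣ) :=
  if h : p.1 = q.1 then 1 else
  Function.Involutive.toPerm
    (fun ω => if ω.1 = p.1 then (q.1, ω.2 * (p.2 * q.2)) else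
      if ω.1 = q.1 then (p.1, ω.2 * (p.2 * q.2)) else ω) fun ω => by
    have hu : ∀ u : ℤˣ, u * u = 1 := Int.units_mul_self
    obtain ⟨i, e⟩ := ω
    by_cases h1 : i = p.1
    · subst h1
      simp [Ne.symm h, mul_assoc, hu (p.2 * q.2)]
    · by_cases h2 : i = q.1
      · subst h2
        simp [h1, mul_assoc, hu (p.2 * q.2)]
      · simp [h1, h2]

variable {p q r s : ι × ℤˣ}

lemma signedSwap_apply (h : p.1 ≠ q.1) (ω : ι × ℤˣ) :
    signedSwap p q ω = if ω.1 = p.1 then (q.1, ω.2 * (p.2 * q.2)) else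
      if ω.1 = q.1 then (p.1, ω.2 * (p.2 * q.2)) else ω := by
  rw [signedSwap, dif_neg h]
  rfl

lemma signedSwap_comm (p q : ι × ℤˣ) : signedSwap p q = signedSwap q p := by
  by_cases h : p.1 = q.1
  · simp [signedSwap, h]
  · ext1 ω
    rw [signedSwap_apply h, signedSwap_apply (Ne.symm h), mul_comm p.2 q.2]
    by_cases h1 : ω.1 = p.1
    · have : ω.1 ≠ q.1 := fun h2 => h (h1.symm.trans h2)
      simp [h1, h]
    · simp [h1]

lemma isSignedMatching_signedSwap (h : p.1 ≠ q.1) :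
    IsSignedMatching (signedSwap p q) {p.1, q.1} := by
  refine ⟨fun ω => ?_, fun ω => ?_, fun ω hω => ?_, fun ω hω => ?_⟩
  · rw [signedSwap, dif_neg h]
    exact Function.Involutive.toPerm_involutive _ ω
  · simp only [signedSwap_apply h, signFlip_apply]
    split_ifs <;> simp
  · simp only [Finset.mem_insert, Finset.mem_singleton, not_or] at hω
    simp [signedSwap_apply h, hω]
  · simp only [Finset.mem_insert, Finset.mem_singleton] at hω
    rw [signedSwap_apply h]
    rcases hω with h1 | h1
    · simpa [h1] using h.symm
    · simpa [h1, h.symm] using h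

lemma signedSwap_left (h : p.1 ≠ q.1) : signedSwap p q p = q := by
  rw [signedSwap_apply h, if_pos rfl, ← mul_assoc, Int.units_mul_self, one_mul]

lemma signedSwap_right (h : p.1 ≠ q.1) : signedSwap p q q = p := by
  rw [signedSwap_comm, signedSwap_left h.symm]

lemma signedSwap_of_ne (hp : r.1 ≠ p.1) (hq : r.1 ≠ q.1) : signedSwap p q r = r := by
  by_cases h : p.1 = q.1
  · simp [signedSwap, h]
  · rw [signedSwap_apply h, if_neg hp, if_neg hq]

lemma commute_signedSwap_signFlip (p q : ι × ℤˣ) : Commute (signedSwap p q) (signFlip ι) := by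
  by_cases h : p.1 = q.1
  · simp [signedSwap, h]
  · exact commute_iff_apply.2 (isSignedMatching_signedSwap h).apply_signFlip

lemma commute_signedSwap_mul (hpq : p.1 ≠ q.1) (hpr : p.1 ≠ r.1) (hps : p.1 ≠ s.1)
    (hqr : q.1 ≠ r.1) (hqs : q.1 ≠ s.1) (hrs : r.1 ≠ s.1) :
    Commute (signedSwap p q * signedSwap r s) (signedSwap p r * signedSwap q s) := by
  rw [commute_iff_apply]
  intro ω
  have hc := fun t => apply_comm_of_fst_eq (p := t) (ω := ω)
    ((commute_signedSwap_signFlip p q).mul_left (commute_signedSwap_signFlip r s))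
    ((commute_signedSwap_signFlip p r).mul_left (commute_signedSwap_signFlip q s))
  have := hpq.symm
  have := hpr.symm
  have := hps.symm
  have := hqr.symm
  have := hqs.symm
  have := hrs.symm
  by_cases h1 : ω.1 = p.1
  · refine hc p ?_ h1
    simp [signedSwap_left, signedSwap_of_ne, *]
  by_cases h2 : ω.1 = q.1
  · refine hc q ?_ h2
    simp [signedSwap_left, signedSwap_right, signedSwap_of_ne, *]
  by_cases h3 : ω.1 = r.1
  · refine hc r ?_ h3
    simp [signedSwap_left, signedSwap_right, signedSwap_of_ne, *]
  by_cases h4 : ω.1 = s.1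
  · refine hc s ?_ h4
    simp [signedSwap_right, signedSwap_of_ne, *]
  simp [signedSwap_of_ne, *]

end SignedSwap
end SignedMatchings

section CommonCommuting

variable {ι : Type*} {x y : Equiv.Perm (ι × ℤˣ)} {S A : Finset ι}

/-- The abelian subgroup generated by `x * y` and the change of sign. -/
def rotations (x y : Equiv.Perm (ι × ℤˣ)) : Subgroup (Equiv.Perm (ι × ℤˣ)) :=
  Subgroup.closure {x * y, signFlip ι}

lemma signFlip_mem_rotations : signFlip ι ∈ rotations x y :=
  Subgroup.subset_closure (by simp)

lemma mul_mem_rotations : x * y ∈ rotations x y :=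
  Subgroup.subset_closure (by simp)

lemma signFlip_mul_self : signFlip ι * signFlip ι = 1 := by
  ext1 ω
  simp

namespace IsSignedMatching

lemma mul_self (hx : IsSignedMatching x S) : x * x = 1 :=
  Equiv.ext hx.apply_apply

lemma commute_signFlip (hx : IsSignedMatching x S) : Commute x (signFlip ι) :=
  commute_iff_apply.2 hx.apply_signFlip

lemma mem_rotations_iff (hx : IsSignedMatching x S) (hy : IsSignedMatching y S)
    {g : Equiv.Perm (ι × ℤˣ)} :
    g ∈ rotations x y ↔ ∃ k : ℤ, g = (x * y) ^ k ∨ g = signFlip ι * (x * y) ^ k := by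
  have hc : Commute (signFlip ι) (x * y) :=
    (hx.commute_signFlip.mul_left hy.commute_signFlip).symm
  constructor
  · intro hg
    induction hg using Subgroup.closure_induction with
    | mem g hg =>
      rcases hg with rfl | rfl
      · exact ⟨1, by simp⟩
      · exact ⟨0, by simp⟩
    | one => exact ⟨0, by simp⟩
    | mul a b _ _ ha hb =>
      obtain ⟨j, hj⟩ := ha
      obtain ⟨k, hk⟩ := hb
      refine ⟨j + k, ?_⟩
      have h1 := (hc.zpow_right j).eq
      rcases hj with rfl | rfl <;> rcases hk with rfl | rfl
      · exact Or.inl (zpow_add _ _ _).symm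
      · right
        rw [← mul_assoc, ← h1, mul_assoc, zpow_add]
      · right
        rw [mul_assoc, zpow_add]
      · left
        rw [h1, mul_assoc, ← mul_assoc (signFlip ι), signFlip_mul_self, one_mul, zpow_add]
    | inv a _ ha =>
      obtain ⟨j, hj⟩ := ha
      refine ⟨-j, ?_⟩
      rcases hj with rfl | rfl
      · exact Or.inl (zpow_neg _ _).symm
      · right
        rw [mul_inv_rev, zpow_neg, inv_eq_of_mul_eq_one_right signFlip_mul_self]
        exact ((hc.zpow_right j).inv_right.eq).symm
  · rintro ⟨k, rfl | rfl⟩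
    · exact Subgroup.zpow_mem _ mul_mem_rotations k
    · exact Subgroup.mul_mem _ signFlip_mem_rotations
        (Subgroup.zpow_mem _ mul_mem_rotations k)

lemma mul_zpow_mul (hx : IsSignedMatching x S) (hy : IsSignedMatching y S) (k : ℤ) :
    y * (x * y) ^ k * y = ((x * y) ^ k)⁻¹ := by
  have hyi : y⁻¹ = y := inv_eq_of_mul_eq_one_right hy.mul_self
  have hxi : x⁻¹ = x := inv_eq_of_mul_eq_one_right hx.mul_self
  have h := conj_zpow (i := k) (a := y) (b := x * y)
  rw [hyi] at h
  rw [← h, ← inv_zpow]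
  congr 1
  rw [mul_inv_rev, hxi, hyi, ← mul_assoc, mul_assoc, hy.mul_self, mul_one]

lemma rotation_conj (hx : IsSignedMatching x S) (hy : IsSignedMatching y S)
    {g : Equiv.Perm (ι × ℤˣ)} (hg : g ∈ rotations x y) : y * g * y = g⁻¹ := by
  obtain ⟨k, rfl | rfl⟩ := (mem_rotations_iff hx hy).1 hg
  · exact mul_zpow_mul hx hy k
  · have hc : Commute (signFlip ι) (x * y) :=
      (hx.commute_signFlip.mul_left hy.commute_signFlip).symm
    rw [← mul_assoc, hy.commute_signFlip.eq, mul_assoc, mul_assoc, ← mul_assoc y,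
      mul_zpow_mul hx hy, mul_inv_rev, inv_eq_of_mul_eq_one_right signFlip_mul_self]
    exact (hc.zpow_right k).inv_right.eq

lemma rotation_apply (hx : IsSignedMatching x S) (hy : IsSignedMatching y S)
    {g : Equiv.Perm (ι × ℤˣ)} (hg : g ∈ rotations x y) (ω : ι × ℤˣ) :
    y (g ω) = g⁻¹ (y ω) := by
  rw [← rotation_conj hx hy hg]
  simp [Equiv.Perm.mul_apply, hy.apply_apply]

lemma rotation_comm (hx : IsSignedMatching x S) (hy : IsSignedMatching y S)
    {g h : Equiv.Perm (ι × ℤˣ)} (hg : g ∈ rotations x y) (hh : h ∈ rotations x y) :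
    g * h = h * g := by
  have := rotation_conj hx hy (Subgroup.mul_mem _ hg hh)
  rw [show y * (g * h) * y = (y * g * y) * (y * h * y) by
    simp only [mul_assoc]; rw [← mul_assoc y y, hy.mul_self, one_mul],
    rotation_conj hx hy hg, rotation_conj hx hy hh, ← mul_inv_rev, inv_inj] at this
  exact this.symm

lemma commute_signFlip_of_mem_rotations (hx : IsSignedMatching x S) (hy : IsSignedMatching y S)
    {g : Equiv.Perm (ι × ℤˣ)} (hg : g ∈ rotations x y) : Commute g (signFlip ι) :=
  rotation_comm hx hy hg signFlip_mem_rotations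

lemma preserves_of_mem_rotations (hx : Preserves x A) (hy : Preserves y A)
    {g : Equiv.Perm (ι × ℤˣ)} (hg : g ∈ rotations x y) : Preserves g A := by
  induction hg using Subgroup.closure_induction with
  | mem g hg =>
    rcases hg with rfl | rfl
    · exact fun ω => (hx _).trans (hy _)
    · exact fun ω => Iff.rfl
  | one => exact fun ω => Iff.rfl
  | mul a b _ _ ha hb => exact fun ω => (ha _).trans (hb _)
  | inv a _ ha => exact fun ω => by simpa using (ha (a⁻¹ ω)).symm

lemma fst_eq_of_fst_apply_eq {g : Equiv.Perm (ι × ℤˣ)} (hg : Commute g (signFlip ι))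
    {ω ω' : ι × ℤˣ} (h : (g ω).1 = (g ω').1) : ω.1 = ω'.1 := by
  rw [commute_iff_apply] at hg
  rcases eq_or_eq_signFlip h with h | h
  · exact congrArg Prod.fst (g.injective h).symm
  · rw [← hg] at h
    rw [g.injective h]
    rfl

lemma rotation_mul_fst_ne (hx : IsSignedMatching x S) (hy : IsSignedMatching y S)
    {g : Equiv.Perm (ι × ℤˣ)} (hg : g ∈ rotations x y) {ω : ι × ℤˣ} (hω : ω.1 ∈ S) :
    (g (y ω)).1 ≠ ω.1 := by
  wlog hk : ∃ k : ℤ, g = (x * y) ^ k generalizing g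
  · obtain ⟨k, rfl | rfl⟩ := (mem_rotations_iff hx hy).1 hg
    · exact absurd ⟨k, rfl⟩ hk
    · exact this (g := (x * y) ^ k) (Subgroup.zpow_mem _ mul_mem_rotations k) ⟨k, rfl⟩
  obtain ⟨k, rfl⟩ := hk
  intro h
  obtain ⟨j, rfl | rfl⟩ := Int.even_or_odd' k
  · have hj := Subgroup.zpow_mem (rotations x y) mul_mem_rotations j
    set g := (x * y) ^ j with hgdef
    have h2 : (g (y (g⁻¹ ω))).1 = (g (g⁻¹ ω)).1 := by
      rw [rotation_apply hx hy (Subgroup.inv_mem _ hj), inv_inv, ← Equiv.Perm.mul_apply, ← zpow_add,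
        ← two_mul, h]
      simp
    refine hy.fst_ne (g⁻¹ ω) ?_
      (fst_eq_of_fst_apply_eq (commute_signFlip_of_mem_rotations hx hy hj) h2)
    exact (preserves_of_mem_rotations hx.preserves_support hy.preserves_support
      (Subgroup.inv_mem _ hj) ω).2 hω
  · have hj := Subgroup.zpow_mem (rotations x y) mul_mem_rotations j
    set g := (x * y) ^ j with hgdef
    have h2 : (g (x (g⁻¹ ω))).1 = (g (g⁻¹ ω)).1 := by
      have hxy : x (g⁻¹ ω) = (x * y) (y (g⁻¹ ω)) := by
        simp [hy.apply_apply]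
      rw [hxy, rotation_apply hx hy (Subgroup.inv_mem _ hj), inv_inv, ← Equiv.Perm.mul_apply,
        ← Equiv.Perm.mul_apply, hgdef, ← zpow_add_one, ← zpow_add,
        show j + 1 + j = 2 * j + 1 by ring, h]
      simp
    refine hx.fst_ne (g⁻¹ ω) ?_
      (fst_eq_of_fst_apply_eq (commute_signFlip_of_mem_rotations hx hy hj) h2)
    exact (preserves_of_mem_rotations hx.preserves_support hy.preserves_support
      (Subgroup.inv_mem _ hj) ω).2 hω

/-- Two signed matchings with the same support commute with a common signed matching. -/
lemma exists_commute_commute (hx : IsSignedMatching x S) (hy : IsSignedMatching y S) :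
    ∃ z, IsSignedMatching z S ∧ Commute z x ∧ Commute z y ∧
      (∀ A, Preserves x A → Preserves y A → Preserves z A) ∧
      ∀ ω : ι × ℤˣ, ω.1 ∈ S → ∃ p, p.1 ∈ S ∧ z p = y p := by
  let r : Setoid (ι × ℤˣ) :=
    { r := fun ω ω' => ∃ g ∈ rotations x y, ω' = g ω ∨ ω' = g (y ω)
      iseqv :=
        { refl := fun (ω : ι × ℤˣ) => ⟨1, Subgroup.one_mem _, Or.inl rfl⟩
          symm := by
            rintro ω _ ⟨g, hg, rfl | rfl⟩
            · exact ⟨g⁻¹, Subgroup.inv_mem _ hg, Or.inl (by simp)⟩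
            · exact ⟨g, hg, Or.inr (by simp [rotation_apply hx hy hg, hy.apply_apply])⟩
          trans := by
            rintro ω _ _ ⟨g, hg, rfl | rfl⟩ ⟨h, hh, rfl | rfl⟩
            · exact ⟨h * g, Subgroup.mul_mem _ hh hg, Or.inl rfl⟩
            · exact ⟨h * g⁻¹, Subgroup.mul_mem _ hh (Subgroup.inv_mem _ hg),
                Or.inr (by simp [rotation_apply hx hy hg])⟩
            · exact ⟨h * g, Subgroup.mul_mem _ hh hg, Or.inr rfl⟩
            · exact ⟨h * g⁻¹, Subgroup.mul_mem _ hh (Subgroup.inv_mem _ hg),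
                Or.inl (by simp [rotation_apply hx hy hg, hy.apply_apply])⟩ } }
  let t : ι × ℤˣ → ι × ℤˣ := fun ω => (Quotient.mk r ω).out
  have ht : ∀ ω, r (t ω) ω := fun ω => Quotient.mk_out (s := r) ω
  have ht' : ∀ ω ω', r ω ω' → t ω = t ω' := fun ω ω' h =>
    congrArg Quotient.out (Quotient.sound (s := r) h)
  let R : ι × ℤˣ → ι × ℤˣ → ι × ℤˣ → Prop := fun p ω ω' =>
    ∃ g ∈ rotations x y, (ω = g p ∧ ω' = g (y p)) ∨ (ω = g (y p) ∧ ω' = g p)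
  have hRsymm : ∀ p ω ω', R p ω ω' → R p ω' ω := by
    rintro p ω ω' ⟨g, hg, h⟩
    exact ⟨g, hg, h.symm.imp And.symm And.symm⟩
  have hRy : ∀ p ω ω', R p ω ω' → R p (y ω) (y ω') := by
    rintro p ω ω' ⟨g, hg, ⟨rfl, rfl⟩ | ⟨rfl, rfl⟩⟩
    · exact ⟨g⁻¹, Subgroup.inv_mem _ hg,
        Or.inr (by simp [rotation_apply hx hy hg, hy.apply_apply])⟩
    · exact ⟨g⁻¹, Subgroup.inv_mem _ hg,
        Or.inl (by simp [rotation_apply hx hy hg, hy.apply_apply])⟩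
  have hRg : ∀ p ω ω', ∀ h ∈ rotations x y, R p ω ω' → R p (h ω) (h ω') := by
    rintro p ω ω' h hh ⟨g, hg, ⟨rfl, rfl⟩ | ⟨rfl, rfl⟩⟩
    · exact ⟨h * g, Subgroup.mul_mem _ hh hg, Or.inl ⟨rfl, rfl⟩⟩
    · exact ⟨h * g, Subgroup.mul_mem _ hh hg, Or.inr ⟨rfl, rfl⟩⟩
  have hRtotal : ∀ ω, ∃ ω', R (t ω) ω ω' := by
    intro ω
    obtain ⟨g, hg, h | h⟩ := ht ω
    · exact ⟨_, g, hg, Or.inl ⟨h, rfl⟩⟩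
    · exact ⟨_, g, hg, Or.inr ⟨h, rfl⟩⟩
  have hstab : ∀ p, ∀ g ∈ rotations x y, ∀ h ∈ rotations x y, g p = h p →
      g (y p) = h (y p) := by
    intro p g hg h hh heq
    have h1 : (h⁻¹ * g) p = p := by simp [heq]
    have h2 := rotation_apply hx hy (Subgroup.mul_mem _ (Subgroup.inv_mem _ hh) hg) p
    rw [h1] at h2
    have h3 : (h⁻¹ * g) (y p) = y p := by
      nth_rewrite 1 [h2]
      simp
    exact Equiv.Perm.inv_eq_iff_eq.1 h3
  have hcross : ∀ p, ∀ g ∈ rotations x y, ∀ h ∈ rotations x y, g p = h (y p) →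
      g (y p) = h p := by
    intro p g hg h hh heq
    by_cases hp : p.1 ∈ S
    · refine absurd ?_ (rotation_mul_fst_ne hx hy
        (Subgroup.mul_mem _ (Subgroup.inv_mem _ hg) hh) hp)
      simp [← heq]
    · rw [hy.apply_of_notMem p hp] at heq ⊢
      exact heq
  have hRunique : ∀ p ω a b, R p ω a → R p ω b → a = b := by
    rintro p ω a b ⟨g, hg, ⟨h1, rfl⟩ | ⟨h1, rfl⟩⟩ ⟨h, hh, ⟨h2, rfl⟩ | ⟨h2, rfl⟩⟩
    · exact hstab p g hg h hh (h1.symm.trans h2)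
    · exact hcross p g hg h hh (h1.symm.trans h2)
    · exact (hcross p h hh g hg (h2.symm.trans h1)).symm
    · have := hstab (y p) g hg h hh (h1.symm.trans h2)
      rwa [hy.apply_apply] at this
  have hRconj : ∀ p ω a, R p ω a → ∃ g ∈ rotations x y, a = g (y (g⁻¹ ω)) := by
    rintro p ω a ⟨g, hg, ⟨rfl, rfl⟩ | ⟨rfl, rfl⟩⟩
    · exact ⟨g, hg, by simp⟩
    · exact ⟨g, hg, by simp [hy.apply_apply]⟩
  have hRr : ∀ p ω a, R p ω a → r ω a := by
    intro p ω a h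
    obtain ⟨g, hg, rfl⟩ := hRconj p ω a h
    exact ⟨g * g, Subgroup.mul_mem _ hg hg, Or.inr
      (by rw [rotation_apply hx hy (Subgroup.inv_mem _ hg), inv_inv]; rfl)⟩
  choose f hf using hRtotal
  have hfeq : ∀ ω a, R (t ω) ω a → f ω = a := fun ω a h => hRunique _ _ _ _ (hf ω) h
  have hff : Function.Involutive f := by
    intro ω
    apply hfeq
    rw [← ht' _ _ (hRr _ _ _ (hf ω))]
    exact hRsymm _ _ _ (hf ω)
  have hfy : ∀ ω, f (y ω) = y (f ω) := by
    intro ω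
    apply hfeq
    rw [← ht' ω (y ω) ⟨1, Subgroup.one_mem _, Or.inr rfl⟩]
    exact hRy _ _ _ (hf ω)
  have hfg : ∀ g ∈ rotations x y, ∀ ω, f (g ω) = g (f ω) := by
    intro g hg ω
    apply hfeq
    rw [← ht' ω (g ω) ⟨g, hg, Or.inl rfl⟩]
    exact hRg _ _ _ g hg (hf ω)
  have hmem : ∀ A, Preserves x A → Preserves y A → ∀ g ∈ rotations x y, Preserves g A :=
    fun A h1 h2 g hg => preserves_of_mem_rotations h1 h2 hg
  have hS := hmem S hx.preserves_support hy.preserves_support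
  refine ⟨hff.toPerm, ⟨hff, hfg _ signFlip_mem_rotations, fun ω hω => ?_, fun ω hω => ?_⟩,
    ?_, ?_, fun A h1 h2 ω => ?_, fun ω hω => ?_⟩
  · obtain ⟨g, hg, h⟩ := hRconj _ _ _ (hf ω)
    have : (g⁻¹ ω).1 ∉ S := by rwa [hS _ (Subgroup.inv_mem _ hg)]
    rw [hy.apply_of_notMem _ this] at h
    simpa using h
  · obtain ⟨g, hg, h⟩ := hRconj _ _ _ (hf ω)
    intro h2
    refine hy.fst_ne (g⁻¹ ω) ((hS _ (Subgroup.inv_mem _ hg) ω).2 hω)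
      (fst_eq_of_fst_apply_eq (commute_signFlip_of_mem_rotations hx hy hg) ?_)
    rw [← h]
    simpa using h2
  · rw [commute_iff_apply]
    intro ω
    have hxy : ∀ ω, x ω = (x * y) (y ω) := fun ω => by simp [hy.apply_apply]
    show f (x ω) = x (f ω)
    rw [hxy, hxy, hfg _ mul_mem_rotations, hfy]
  · rw [commute_iff_apply]
    exact hfy
  · obtain ⟨g, hg, h⟩ := hRconj _ _ _ (hf ω)
    show (f ω).1 ∈ A ↔ _
    rw [h, hmem A h1 h2 g hg, h2, hmem A h1 h2 _ (Subgroup.inv_mem _ hg)]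
  · refine ⟨t ω, ?_, ?_⟩
    · obtain ⟨g, hg, h | h⟩ := ht ω
      · rwa [h, hS g hg] at hω
      · rwa [h, hS g hg, hy.preserves_support] at hω
    · apply hfeq
      rw [show t (t ω) = t ω from ht' _ _ (ht ω)]
      exact ⟨1, Subgroup.one_mem _, Or.inl ⟨rfl, rfl⟩⟩

end IsSignedMatching

end CommonCommuting

section Chains

variable {ι : Type*} {x y z : Equiv.Perm (ι × ℤˣ)} {S T K A : Finset ι}
  {p q : ι × ℤˣ}

lemma apply_eq_of_fst_eq (hx : Commute x (signFlip ι)) (hy : Commute y (signFlip ι))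
    {ω : ι × ℤˣ} (h : x p = y p) (hω : ω.1 = p.1) : x ω = y ω := by
  rw [commute_iff_apply] at hx hy
  rcases eq_or_eq_signFlip hω.symm with rfl | rfl
  · exact h
  · rw [hx, hy, h]

lemma Preserves.mul (hx : Preserves x A) (hy : Preserves y A) : Preserves (x * y) A :=
  fun ω => (hx _).trans (hy ω)

namespace IsSignedMatching

lemma preserves_of_disjoint (hx : IsSignedMatching x S) (h : Disjoint S A) : Preserves x A :=
  hx.preserves_of_imp fun ω hω => by
    rwa [hx.apply_of_notMem ω (Finset.disjoint_right.1 h hω)]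

lemma preserves_of_subset (hx : IsSignedMatching x S) (h : S ⊆ A) : Preserves x A :=
  hx.preserves_of_imp fun ω hω => by
    by_cases hS : ω.1 ∈ S
    · exact h ((hx.preserves_support ω).2 hS)
    · rwa [hx.apply_of_notMem ω hS]

lemma preserves_of_imp_support (hx : IsSignedMatching x S)
    (h : ∀ i ∈ S, i ∈ A → (x (i, 1)).1 ∈ A) : Preserves x A :=
  hx.preserves_of_imp fun ω hω => by
    by_cases hS : ω.1 ∈ S
    · rw [hx.fst_congr (ω := ω) (ω' := (ω.1, 1)) rfl]
      exact h _ hS hω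
    · rwa [hx.apply_of_notMem ω hS]

end IsSignedMatching

variable [DecidableEq ι]

lemma Preserves.inter {B : Finset ι} (hA : Preserves x A) (hB : Preserves x B) :
    Preserves x (A ∩ B) := fun ω => by
  rw [Finset.mem_inter, Finset.mem_inter, hA, hB]

lemma Preserves.sdiff {B : Finset ι} (hA : Preserves x A) (hB : Preserves x B) :
    Preserves x (A \ B) := fun ω => by
  rw [Finset.mem_sdiff, Finset.mem_sdiff, hA, hB]

lemma preserves_signedSwap (h : p.1 ∈ A ↔ q.1 ∈ A) : Preserves (signedSwap p q) A := by
  by_cases hpq : p.1 = q.1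
  · intro ω
    simp [signedSwap, hpq]
  · refine (isSignedMatching_signedSwap hpq).preserves_of_imp fun ω hω => ?_
    rw [signedSwap_apply hpq]
    split_ifs with h1 h2
    · exact h.1 (h1 ▸ hω)
    · exact h.2 (h2 ▸ hω)
    · exact hω

namespace IsSignedMatching

lemma preserves_pair (hx : IsSignedMatching x S) (h : x p = q) : Preserves x {p.1, q.1} := by
  refine hx.preserves_of_imp fun ω hω => ?_
  simp only [Finset.mem_insert, Finset.mem_singleton] at hω ⊢
  rcases hω with h1 | h1
  · right
    rw [hx.fst_congr h1, h]
  · left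
    rw [hx.fst_congr h1, ← h, hx.apply_apply]

lemma exists_eq_mul_signedSwap (hx : IsSignedMatching x S) (hp : p.1 ∈ S) (h : x p = q) :
    ∃ x', IsSignedMatching x' (S \ {p.1, q.1}) ∧ x = x' * signedSwap p q := by
  obtain ⟨x', hx', he⟩ := hx.exists_restrict (K := S \ {p.1, q.1}) Finset.sdiff_subset
    (hx.preserves_support.sdiff (hx.preserves_pair h))
  refine ⟨x', hx', Equiv.ext fun ω => ?_⟩
  have hpq : p.1 ≠ q.1 := fun e => hx.fst_ne p hp (by rw [h, e])
  have hc := hx'.commute_signFlip.mul_left (commute_signedSwap_signFlip p q)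
  by_cases h1 : ω.1 = p.1
  · refine apply_eq_of_fst_eq hx.commute_signFlip hc ?_ h1
    rw [Equiv.Perm.mul_apply, signedSwap_left hpq, hx'.apply_of_notMem q (by simp), h]
  by_cases h2 : ω.1 = q.1
  · refine apply_eq_of_fst_eq hx.commute_signFlip hc ?_ h2
    rw [Equiv.Perm.mul_apply, signedSwap_right hpq, hx'.apply_of_notMem p (by simp), ← h,
      hx.apply_apply]
  rw [Equiv.Perm.mul_apply, signedSwap_of_ne h1 h2]
  by_cases hω : ω.1 ∈ S
  · exact (he ω (by simp [*])).symm
  · rw [hx.apply_of_notMem ω hω, hx'.apply_of_notMem ω (by simp [hω])]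

/-- A signed matching commutes with its restrictions. -/
lemma exists_commute_restrict (hx : IsSignedMatching x S) (hK : K ⊆ S) (hp : Preserves x K) :
    ∃ x', IsSignedMatching x' K ∧ (∀ ω, ω.1 ∈ K → x' ω = x ω) ∧ Commute x' x := by
  obtain ⟨x', hx', he⟩ := hx.exists_restrict hK hp
  exact ⟨x', hx', he, hx'.commute_of_eqOn hp (fun ω hω => (he ω hω).symm) (Commute.refl _)⟩

/-- Given a signed matching `x` preserving a subset `K` of its support that meets `A` in an even
number of points, some signed matching supported on `K` commutes with `x` and preserves `A`. -/
lemma exists_commute_preserves (hx : IsSignedMatching x S) (hK : K ⊆ S) (hp : Preserves x K)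
    (hA : Even (K ∩ A).card) :
    ∃ z, IsSignedMatching z K ∧ Commute z x ∧ Preserves z A := by
  induction hn : K.card using Nat.strong_induction_on generalizing K with
  | _ n ih =>
  subst hn
  by_cases hcross : ∀ i ∈ K, i ∈ A → (x (i, 1)).1 ∈ A
  · obtain ⟨x', hx', he, hc⟩ := hx.exists_commute_restrict hK hp
    refine ⟨x', hx', hc, hx'.preserves_of_imp_support fun i hi hiA => ?_⟩
    rw [he _ hi]
    exact hcross i hi hiA
  push Not at hcross
  obtain ⟨i, hiK, hiA, hi⟩ := hcross
  have hcross2 : ∃ j ∈ K, j ∈ A ∧ j ≠ i ∧ (x (j, 1)).1 ∉ A := by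
    by_contra! hno
    have hpres : Preserves x ((K ∩ A).erase i) := by
      refine hx.preserves_of_imp_support fun j _ hj => ?_
      simp only [Finset.mem_erase, Finset.mem_inter] at hj ⊢
      have hjA := hno j hj.2.1 hj.2.2 hj.1
      refine ⟨fun e => ?_, (hp (j, 1)).2 hj.2.1, hjA⟩
      have h2 : (x (i, 1)).1 = (x (x (j, 1))).1 := hx.fst_congr e.symm
      rw [hx.apply_apply] at h2
      exact hi (h2 ▸ hj.2.2)
    have h1 := hx.even_card (fun j hj => hK (Finset.mem_inter.1 (Finset.mem_of_mem_erase hj)).1)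
      hpres
    have hmem : i ∈ K ∩ A := Finset.mem_inter.2 ⟨hiK, hiA⟩
    rw [Finset.card_erase_of_mem hmem] at h1
    have := Finset.card_pos.2 ⟨i, hmem⟩
    obtain ⟨a, ha⟩ := hA
    obtain ⟨b, hb⟩ := h1
    omega
  obtain ⟨j, hjK, hjA, hji, hj⟩ := hcross2
  obtain ⟨p, hp1⟩ : ∃ p : ι × ℤˣ, p = (i, 1) := ⟨_, rfl⟩
  obtain ⟨q, hq1⟩ : ∃ q : ι × ℤˣ, q = (j, 1) := ⟨_, rfl⟩
  have hpi : p.1 = i := by rw [hp1]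
  have hqj : q.1 = j := by rw [hq1]
  rw [← hp1] at hi
  rw [← hq1] at hj
  rw [← hpi] at hiK hiA hji
  rw [← hqj] at hjK hjA hji
  clear hp1 hq1 hpi hqj
  have hpp : p.1 ≠ (x p).1 := (hx.fst_ne p (hK hiK)).symm
  have hqq : q.1 ≠ (x q).1 := (hx.fst_ne q (hK hjK)).symm
  have hpq' : p.1 ≠ (x q).1 := fun e => hj (e ▸ hiA)
  have hqp' : q.1 ≠ (x p).1 := fun e => hi (e ▸ hjA)
  have hpq'' : (x p).1 ≠ (x q).1 := fun e =>
    hji (fst_eq_of_fst_apply_eq hx.commute_signFlip e).symm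
  have hw := (isSignedMatching_signedSwap hji.symm).mul (isSignedMatching_signedSwap hpq'')
    (by simp [hpp.symm, hqq.symm, hpq'.symm, hqp'.symm])
  have hwx : Preserves x ({p.1, q.1} ∪ {(x p).1, (x q).1}) := by
    have : ({p.1, q.1} ∪ {(x p).1, (x q).1} : Finset ι) = {p.1, (x p).1} ∪ {q.1, (x q).1} := by
      ext; simp; tauto
    rw [this]
    intro ω
    rw [Finset.mem_union, Finset.mem_union, hx.preserves_pair rfl, hx.preserves_pair rfl]
  have hwc := commute_signedSwap_mul hji.symm hpp hpq' hqp' hqq hpq''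
  have hwc2 := hw.commute_of_eqOn hwx (fun ω hω => ?_) hwc
  · have hsub : ({p.1, q.1} ∪ {(x p).1, (x q).1} : Finset ι) ⊆ K := by
      intro k
      simp only [Finset.mem_union, Finset.mem_insert, Finset.mem_singleton]
      rintro ((rfl | rfl) | (rfl | rfl))
      · exact hiK
      · exact hjK
      · exact (hp _).2 hiK
      · exact (hp _).2 hjK
    obtain ⟨z', hz', hzx, hzA⟩ := ih (K \ ({p.1, q.1} ∪ {(x p).1, (x q).1})).card
      (Finset.card_lt_card (Finset.sdiff_ssubset hsub ⟨p.1, by simp⟩))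
      (Finset.sdiff_subset.trans hK) (hp.sdiff hwx) (by
        have : (K \ ({p.1, q.1} ∪ {(x p).1, (x q).1})) ∩ A = (K ∩ A) \ {p.1, q.1} := by
          ext k
          simp only [Finset.mem_inter, Finset.mem_sdiff, Finset.mem_union, Finset.mem_insert,
            Finset.mem_singleton]
          constructor
          · tauto
          · rintro ⟨⟨h1, h2⟩, h3⟩
            refine ⟨⟨h1, ?_⟩, h2⟩
            rintro (h | (rfl | rfl))
            · exact h3 h
            · exact hi h2
            · exact hj h2
        rw [this, Finset.card_sdiff_of_subset, Finset.card_pair hji.symm]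
        · exact hA.tsub even_two
        · intro k
          simp only [Finset.mem_inter, Finset.mem_insert, Finset.mem_singleton]
          rintro (rfl | rfl)
          · exact ⟨hiK, hiA⟩
          · exact ⟨hjK, hjA⟩) rfl
    refine ⟨z' * _, ?_, hzx.mul_left hwc2, hzA.mul
      ((preserves_signedSwap (by simp [hiA, hjA])).mul (preserves_signedSwap (by simp [hi, hj])))⟩
    have := hz'.mul hw Finset.sdiff_disjoint
    rwa [Finset.sdiff_union_of_subset hsub] at this
  · have hc := (commute_signedSwap_signFlip p (x p)).mul_left
      (commute_signedSwap_signFlip q (x q))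
    simp only [Finset.mem_union, Finset.mem_insert, Finset.mem_singleton] at hω
    have := hji.symm
    have := hpp.symm
    have := hqq.symm
    have := hpq'.symm
    have := hqp'.symm
    have := hpq''.symm
    rcases hω with (h | h) | (h | h)
    all_goals
      refine apply_eq_of_fst_eq hx.commute_signFlip hc ?_ h
      simp [signedSwap_left, signedSwap_right, signedSwap_of_ne, hx.apply_apply, *]

/-- Two signed matchings preserving the supports of each other commute with a common signed
matching having the same support as the first one. -/
lemma exists_commute_of_preserves {z' : Equiv.Perm (ι × ℤˣ)} {T' : Finset ι}
    (hz : IsSignedMatching z T) (hz' : IsSignedMatching z' T') (h : Preserves z T')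
    (h' : Preserves z' T) : ∃ w, IsSignedMatching w T ∧ Commute w z ∧ Commute w z' := by
  obtain ⟨a, ha, hae⟩ := hz'.exists_restrict (K := T ∩ T') Finset.inter_subset_right
    (h'.inter hz'.preserves_support)
  obtain ⟨b, hb, -⟩ := hz.exists_restrict (K := T \ T') Finset.sdiff_subset
    (hz.preserves_support.sdiff h)
  have hdisj : Disjoint (T ∩ T') (T \ T') :=
    Finset.disjoint_left.2 fun i hi hi' => (Finset.mem_sdiff.1 hi').2 (Finset.mem_inter.1 hi).2
  have hab := ha.mul hb hdisj
  rw [Finset.union_comm, Finset.sdiff_union_inter] at hab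
  obtain ⟨w, hw, hwz, hwab, hwp, -⟩ := hz.exists_commute_commute hab
  refine ⟨w, hw, hwz, ?_⟩
  have hwT' : Preserves w T' := hwp T' h ((ha.preserves_of_subset Finset.inter_subset_right).mul
    (hb.preserves_of_disjoint Finset.sdiff_disjoint))
  have key : ∀ ω, ω.1 ∈ T → z' ω = (if ω.1 ∈ T' then (a * b) ω else ω) := by
    intro ω hω
    split_ifs with h1
    · rw [Equiv.Perm.mul_apply, hb.apply_of_notMem ω (by simp [h1]), hae ω (by simp [*])]
    · exact hz'.apply_of_notMem ω h1
  rw [commute_iff_apply] at hwab ⊢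
  intro ω
  by_cases hω : ω.1 ∈ T
  · rw [key ω hω, key (w ω) ((hw.preserves_support ω).2 hω)]
    by_cases h1 : ω.1 ∈ T'
    · rw [if_pos h1, if_pos ((hwT' ω).2 h1), hwab]
    · rw [if_neg h1, if_neg (fun h2 => h1 ((hwT' ω).1 h2))]
  · rw [hw.apply_of_notMem ω hω, hw.apply_of_notMem]
    rwa [h' ω]

end IsSignedMatching

end Chains

section ChainTheorem

variable {ι : Type*} [DecidableEq ι] {x y z : Equiv.Perm (ι × ℤˣ)} {S S' T K A R : Finset ι}
  {p q r s : ι × ℤˣ}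

lemma signedSwap_mul_self (p q : ι × ℤˣ) : signedSwap p q * signedSwap p q = 1 := by
  by_cases h : p.1 = q.1
  · simp [signedSwap, h]
  · exact (isSignedMatching_signedSwap h).mul_self

lemma commute_signedSwap_signedSwap (hpr : p.1 ≠ r.1) (hps : p.1 ≠ s.1) (hqr : q.1 ≠ r.1)
    (hqs : q.1 ≠ s.1) : Commute (signedSwap p q) (signedSwap r s) := by
  by_cases hpq : p.1 = q.1
  · simp [signedSwap, hpq]
  by_cases hrs : r.1 = s.1
  · simp [signedSwap, hrs]
  exact (isSignedMatching_signedSwap hpq).commute_of_disjoint (isSignedMatching_signedSwap hrs)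
    (by simp [hpr.symm, hps.symm, hqr.symm, hqs.symm])

namespace IsSignedMatching

lemma commute_signedSwap_of_notMem (hx : IsSignedMatching x S) (hp : p.1 ∉ S) (hq : q.1 ∉ S) :
    Commute x (signedSwap p q) := by
  by_cases hpq : p.1 = q.1
  · simp [signedSwap, hpq]
  exact hx.commute_of_disjoint (isSignedMatching_signedSwap hpq) (by simp [hp, hq])

lemma commute_signedSwap (hx : IsSignedMatching x S) (hp : p.1 ∈ S) (h : x p = q) :
    Commute x (signedSwap p q) := by
  obtain ⟨x', hx', he⟩ := hx.exists_eq_mul_signedSwap hp h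
  rw [he]
  exact (hx'.commute_signedSwap_of_notMem (by simp) (by simp)).mul_left (Commute.refl _)

lemma mul_signedSwap (hx : IsSignedMatching x S) (hp : p.1 ∉ S) (hq : q.1 ∉ S)
    (hpq : p.1 ≠ q.1) :
    IsSignedMatching (x * signedSwap p q) (insert p.1 (insert q.1 S)) := by
  have := hx.mul (isSignedMatching_signedSwap hpq) (by simp [hp, hq])
  rwa [Finset.union_comm, Finset.insert_union, Finset.singleton_union] at this

end IsSignedMatching

/-- `x` and `y` are joined by a path of length four of commuting signed matchings, all interior
ones having supports with `k` points. -/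
def HasChain (k : ℕ) (x y : Equiv.Perm (ι × ℤˣ)) : Prop :=
  ∃ z₁ z₂ z₃ : Equiv.Perm (ι × ℤˣ), ∃ T₁ T₂ T₃ : Finset ι,
    (IsSignedMatching z₁ T₁ ∧ T₁.card = k) ∧ (IsSignedMatching z₂ T₂ ∧ T₂.card = k) ∧
    (IsSignedMatching z₃ T₃ ∧ T₃.card = k) ∧
    Commute z₁ x ∧ Commute z₂ z₁ ∧ Commute z₂ z₃ ∧ Commute z₃ y

namespace IsSignedMatching

lemma hasChain_of_preserves {z₁ z₃ : Equiv.Perm (ι × ℤˣ)} {T₁ T₃ : Finset ι}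
    (h₁ : IsSignedMatching z₁ T₁) (h₃ : IsSignedMatching z₃ T₃) (h : T₃.card = T₁.card)
    (hx : Commute z₁ x) (hy : Commute z₃ y) (h₁₃ : Preserves z₁ T₃) (h₃₁ : Preserves z₃ T₁) :
    HasChain T₁.card x y := by
  obtain ⟨w, hw, hw1, hw3⟩ := h₁.exists_commute_of_preserves h₃ h₁₃ h₃₁
  exact ⟨z₁, w, z₃, T₁, T₁, T₃, ⟨h₁, rfl⟩, ⟨hw, rfl⟩, ⟨h₃, h⟩, hx, hw1, hw3, hy⟩

lemma hasChain_of_even (hx : IsSignedMatching x S) (hy : IsSignedMatching y S')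
    (hc : S'.card = S.card) (h : Even (S ∩ S').card) : HasChain S.card x y := by
  obtain ⟨z₁, h₁, hz₁, hp₁⟩ := hx.exists_commute_preserves subset_rfl hx.preserves_support h
  rw [Finset.inter_comm] at h
  obtain ⟨z₃, h₃, hz₃, hp₃⟩ := hy.exists_commute_preserves subset_rfl hy.preserves_support h
  exact h₁.hasChain_of_preserves h₃ hc hz₁ hz₃ hp₁ hp₃

lemma hasChain_of_odd (hx : IsSignedMatching x S) (hy : IsSignedMatching y S')
    (hc : S'.card = S.card) (h : ¬ Even (S ∩ S').card) {c d : ι} (hcd : c ≠ d) (hcS : c ∉ S)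
    (hdS : d ∉ S) (hS' : c ∈ S' ↔ d ∈ S') : HasChain S.card x y := by
  obtain ⟨p, hpS, hpS', hp⟩ : ∃ p : ι × ℤˣ, p.1 ∈ S ∧ p.1 ∈ S' ∧ (x p).1 ∉ S' := by
    by_contra! hno
    refine h (hx.even_card Finset.inter_subset_left ?_)
    refine hx.preserves_of_imp fun ω hω => ?_
    rw [Finset.mem_inter] at hω ⊢
    exact ⟨(hx.preserves_support ω).2 hω.1, hno ω hω.1 hω.2⟩
  have hsub : ({p.1, (x p).1} : Finset ι) ⊆ S := by
    intro k
    simp only [Finset.mem_insert, Finset.mem_singleton]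
    rintro (rfl | rfl)
    · exact hpS
    · exact (hx.preserves_support p).2 hpS
  have heven : Even ((S \ {p.1, (x p).1}) ∩ S').card := by
    have : (S \ {p.1, (x p).1}) ∩ S' = (S ∩ S').erase p.1 := by
      ext k
      simp only [Finset.mem_inter, Finset.mem_sdiff, Finset.mem_insert, Finset.mem_singleton,
        Finset.mem_erase]
      constructor
      · tauto
      · rintro ⟨h1, h2, h3⟩
        exact ⟨⟨h2, by rintro (h | rfl) <;> contradiction⟩, h3⟩
    rw [this, Finset.card_erase_of_mem (Finset.mem_inter.2 ⟨hpS, hpS'⟩)]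
    exact Nat.Odd.sub_odd (Nat.not_even_iff_odd.1 h) odd_one
  obtain ⟨z, hz, hzx, hzA⟩ := hx.exists_commute_preserves (K := S \ {p.1, (x p).1})
    Finset.sdiff_subset (hx.preserves_support.sdiff (hx.preserves_pair rfl)) heven
  have h₁ := hz.mul_signedSwap (p := (c, 1)) (q := (d, 1)) (by simp [hcS]) (by simp [hdS]) hcd
  have hp₁ := hzA.mul (preserves_signedSwap (p := (c, 1)) (q := (d, 1)) hS')
  have hcard : (insert c (insert d (S \ {p.1, (x p).1}))).card = S.card := by
    have h2 := Finset.card_sdiff_add_card_eq_card hsub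
    rw [Finset.card_pair (hx.fst_ne p hpS).symm] at h2
    rw [Finset.card_insert_of_notMem (by simp [hcd, hcS]),
      Finset.card_insert_of_notMem (by simp [hdS]), ← h2]
  obtain ⟨z₃, h₃, hz₃, hp₃⟩ := hy.exists_commute_preserves subset_rfl hy.preserves_support
    (h₁.even_card Finset.inter_subset_right (hp₁.inter h₁.preserves_support))
  have := h₁.hasChain_of_preserves h₃ (hc.trans hcard.symm)
    (hzx.mul_left (hx.commute_signedSwap_of_notMem hcS hdS).symm) hz₃ hp₁ hp₃
  exact hcard ▸ this

lemma exists_commute_compl [Fintype ι] (hx : IsSignedMatching x S) {c d : ι} (hcd : c ≠ d)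
    (hS : S = Finset.univ \ {c, d}) {e f : Finset ι} (he : e ⊆ S) (hf : f ⊆ S)
    (hef : Disjoint e f) (hfc : f.card = 2) (hp : Preserves x e) :
    ∃ z, IsSignedMatching z (Finset.univ \ e) ∧ Commute z x ∧ Preserves z (Finset.univ \ f) := by
  have hcS : c ∉ S := by simp [hS]
  have hdS : d ∉ S := by simp [hS]
  have hpK := hx.preserves_support.sdiff hp
  have hfK : f ⊆ S \ e := fun i hi =>
    Finset.mem_sdiff.2 ⟨hf hi, Finset.disjoint_right.1 hef hi⟩
  obtain ⟨z, hz, hzx, hzA⟩ := hx.exists_commute_preserves (A := Finset.univ \ f)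
    Finset.sdiff_subset hpK (by
      have : (S \ e) ∩ (Finset.univ \ f) = (S \ e) \ f := by
        ext; simp
      rw [this, Finset.card_sdiff_of_subset hfK, hfc]
      exact (hx.even_card Finset.sdiff_subset hpK).tsub even_two)
  have h₁ := hz.mul_signedSwap (p := (c, 1)) (q := (d, 1)) (by simp [hcS]) (by simp [hdS]) hcd
  refine ⟨_, ?_, hzx.mul_left (hx.commute_signedSwap_of_notMem (p := (c, 1)) (q := (d, 1))
    hcS hdS).symm, hzA.mul (preserves_signedSwap ?_)⟩
  · convert h₁ using 1
    ext i
    have h2 : i ∈ e → i ∈ S := fun h => he h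
    have h3 : i ∈ S ↔ i ≠ c ∧ i ≠ d := by simp [hS]
    simp only [Finset.mem_sdiff, Finset.mem_univ, true_and, Finset.mem_insert]
    tauto
  · have h2 : c ∉ f := fun h => hcS (hf h)
    have h3 : d ∉ f := fun h => hdS (hf h)
    simp [h2, h3]

lemma hasChain_mul_signedSwap (hxR : IsSignedMatching x R) (hyR : IsSignedMatching y R)
    {p₀ p₁ p₂ p₃ p₄ c : ι × ℤˣ} (hR : ∀ i ∈ [p₀.1, p₁.1, p₂.1, p₃.1, p₄.1, c.1], i ∉ R)
    (hnd : [p₀.1, p₁.1, p₂.1, p₃.1, p₄.1, c.1].Nodup) :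
    HasChain (R.card + 4) (x * signedSwap p₂ p₃ * signedSwap p₀ p₁)
      (y * signedSwap p₃ p₄ * signedSwap p₁ p₂) := by
  simp only [List.forall_mem_cons, List.not_mem_nil, IsEmpty.forall_iff, implies_true,
    and_true] at hR
  obtain ⟨h0R, h1R, h2R, h3R, h4R, hcR⟩ := hR
  simp only [List.nodup_cons, List.mem_cons, List.not_mem_nil, or_false, not_or, not_false_eq_true,
    List.nodup_nil, and_true] at hnd
  obtain ⟨⟨h01, h02, h03, h04, h0c⟩, ⟨h12, h13, h14, h1c⟩, ⟨h23, h24, h2c⟩, ⟨h34, h3c⟩, h4c⟩ := hnd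
  have h10 := Ne.symm h01
  have h20 := Ne.symm h02
  have h30 := Ne.symm h03
  have h40 := Ne.symm h04
  have hc0 := Ne.symm h0c
  have h21 := Ne.symm h12
  have h31 := Ne.symm h13
  have h41 := Ne.symm h14
  have hc1 := Ne.symm h1c
  have h32 := Ne.symm h23
  have h42 := Ne.symm h24
  have hc2 := Ne.symm h2c
  have h43 := Ne.symm h34
  have hc3 := Ne.symm h3c
  have hc4 := Ne.symm h4c
  obtain ⟨τ, hτ, hτx, hτy, -⟩ := hxR.exists_commute_commute hyR
  have hz₁ := (hτ.mul_signedSwap h0R h3R (by assumption)).mul_signedSwap (p := p₁) (q := p₂)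
    (by simp [*]) (by simp [*]) (by assumption)
  have hz₂ := (hτ.mul_signedSwap h0R h3R (by assumption)).mul_signedSwap (p := p₄) (q := c)
    (by simp [*]) (by simp [*]) (by assumption)
  have hz₃ := (hτ.mul_signedSwap h3R h4R (by assumption)).mul_signedSwap (p := p₀) (q := c)
    (by simp [*]) (by simp [*]) (by assumption)
  have hkey₁ : Commute (signedSwap p₀ p₃ * signedSwap p₁ p₂)
      (signedSwap p₂ p₃ * signedSwap p₀ p₁) := by
    rw [(commute_signedSwap_signedSwap (by assumption) (by assumption) (by assumption)
      (by assumption) : Commute (signedSwap p₂ p₃) (signedSwap p₀ p₁)).eq, signedSwap_comm p₂ p₃]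
    apply commute_signedSwap_mul <;> assumption
  have hkey₂ : Commute (signedSwap p₀ p₃ * signedSwap p₄ c)
      (signedSwap p₃ p₄ * signedSwap p₀ c) := by
    rw [(commute_signedSwap_signedSwap (by assumption) (by assumption) (by assumption)
      (by assumption) : Commute (signedSwap p₃ p₄) (signedSwap p₀ c)).eq, signedSwap_comm p₄ c]
    apply commute_signedSwap_mul <;> assumption
  refine ⟨_, _, _, _, _, _, ⟨hz₁, ?_⟩, ⟨hz₂, ?_⟩, ⟨hz₃, ?_⟩, ?_, ?_, ?_, ?_⟩
  · simp [*]
  · simp [*]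
  · simp [*]
  · rw [mul_assoc, mul_assoc]
    refine Commute.mul_left (Commute.mul_right hτx ?_) (Commute.mul_right ?_ hkey₁)
    · exact (hτ.commute_signedSwap_of_notMem h2R h3R).mul_right
        (hτ.commute_signedSwap_of_notMem h0R h1R)
    · exact ((hxR.commute_signedSwap_of_notMem h0R h3R).mul_right
        (hxR.commute_signedSwap_of_notMem h1R h2R)).symm
  · refine Commute.mul_left ?_ ?_ <;> refine Commute.mul_right ?_ ?_
    · exact Commute.refl _
    · exact (hτ.commute_signedSwap_of_notMem h1R h2R).mul_left
        (by apply commute_signedSwap_signedSwap <;> assumption)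
    · exact ((hτ.commute_signedSwap_of_notMem h4R hcR).mul_left
        (by apply commute_signedSwap_signedSwap <;> assumption)).symm
    · apply commute_signedSwap_signedSwap <;> assumption
  · rw [mul_assoc, mul_assoc]
    refine Commute.mul_left (Commute.mul_right (Commute.refl _) ?_) (Commute.mul_right ?_ hkey₂)
    · exact (hτ.commute_signedSwap_of_notMem h3R h4R).mul_right
        (hτ.commute_signedSwap_of_notMem h0R hcR)
    · exact ((hτ.commute_signedSwap_of_notMem h0R h3R).mul_right
        (hτ.commute_signedSwap_of_notMem h4R hcR)).symm
  · refine Commute.mul_left (Commute.mul_left ?_ ?_) ?_ <;>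
      refine Commute.mul_right (Commute.mul_right ?_ ?_) ?_
    · exact hτy
    · exact hτ.commute_signedSwap_of_notMem h3R h4R
    · exact hτ.commute_signedSwap_of_notMem h1R h2R
    · exact (hyR.commute_signedSwap_of_notMem h3R h4R).symm
    · exact Commute.refl _
    · apply commute_signedSwap_signedSwap <;> assumption
    · exact (hyR.commute_signedSwap_of_notMem h0R hcR).symm
    · apply commute_signedSwap_signedSwap <;> assumption
    · apply commute_signedSwap_signedSwap <;> assumption

section TwoFixed

variable {c d d' : ι}

lemma hasChain_of_path_two [Fintype ι] (h5 : 5 ≤ Fintype.card ι) (hx : IsSignedMatching x S)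
    (hy : IsSignedMatching y S') (hS : S = Finset.univ \ {c, d}) (hS' : S' = Finset.univ \ {c, d'})
    (hcd : c ≠ d) (hcd' : c ≠ d') (hdd' : d ≠ d') {p₀ p₁ p₂ : ι × ℤˣ} (h₀ : p₀.1 = d')
    (h₁ : x p₀ = p₁) (h₂ : y p₁ = p₂) (hd : p₂.1 = d) : HasChain S.card x y := by
  subst h₀ hd
  have h0S : p₀.1 ∈ S := by simp [hS, hcd'.symm, hdd'.symm]
  have h1S : p₁.1 ∈ S := h₁ ▸ (hx.preserves_support _).2 h0S
  have h01 : p₀.1 ≠ p₁.1 := h₁ ▸ (hx.fst_ne p₀ h0S).symm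
  have h1S' : p₁.1 ∈ S' := by
    simp only [hS, Finset.mem_sdiff, Finset.mem_insert, not_or] at h1S
    simp [hS', h1S.2.1, h01.symm]
  have h12 : p₁.1 ≠ p₂.1 := h₂ ▸ (hy.fst_ne p₁ h1S').symm
  have h1c : p₁.1 ≠ c := by
    simp only [hS, Finset.mem_sdiff, Finset.mem_insert, not_or] at h1S
    exact h1S.2.1
  obtain ⟨xR, hxR, hxe⟩ := hx.exists_eq_mul_signedSwap h0S h₁
  obtain ⟨yR, hyR, hye⟩ := hy.exists_eq_mul_signedSwap h1S' h₂
  obtain ⟨R, hR⟩ : ∃ R, R = S \ {p₀.1, p₁.1} := ⟨_, rfl⟩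
  have hR' : S' \ {p₁.1, p₂.1} = R := by
    ext i
    simp [hR, hS, hS']
    tauto
  rw [← hR] at hxR
  rw [hR'] at hyR
  have h0R : p₀.1 ∉ R := by simp [hR]
  have h1R : p₁.1 ∉ R := by simp [hR]
  have h2R : p₂.1 ∉ R := by simp [hR, hS]
  have hcR : c ∉ R := by simp [hR, hS]
  have hcard : R.card + 2 = S.card := by
    rw [hR, ← Finset.card_pair h01]
    refine Finset.card_sdiff_add_card_eq_card fun k => ?_
    simp only [Finset.mem_insert, Finset.mem_singleton]
    rintro (rfl | rfl) <;> assumption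
  have hScard : S.card + 2 = Fintype.card ι := by
    rw [hS, ← Finset.card_pair hcd]
    exact Finset.card_sdiff_add_card_eq_card (Finset.subset_univ _)
  obtain ⟨τ, hτ, hτx, hτy, -, hex⟩ := hxR.exists_commute_commute hyR
  obtain ⟨i, hi⟩ := Finset.card_pos.1 (by omega : 0 < R.card)
  obtain ⟨p, hpR, hp⟩ := hex (i, 1) hi
  obtain ⟨τ', hτ', hτe⟩ := hτ.exists_eq_mul_signedSwap hpR hp
  have hτ2 : τ' = τ * signedSwap p (yR p) := by
    rw [hτe, mul_assoc, signedSwap_mul_self, mul_one]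
  have hτ'y : Commute τ' yR := by
    rw [hτ2]
    exact hτy.mul_left (hyR.commute_signedSwap hpR rfl).symm
  have hτ'τ : Commute τ' τ := by
    rw [hτ2]
    exact (Commute.refl τ).mul_left (hτ.commute_signedSwap hpR hp).symm
  have hsub : R \ {p.1, (yR p).1} ⊆ R := Finset.sdiff_subset
  have hcard' : (R \ {p.1, (yR p).1}).card + 2 = R.card := by
    rw [← Finset.card_pair (hyR.fst_ne p hpR).symm]
    refine Finset.card_sdiff_add_card_eq_card fun k => ?_
    simp only [Finset.mem_insert, Finset.mem_singleton]
    rintro (rfl | rfl)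
    · exact hpR
    · exact (hyR.preserves_support p).2 hpR
  obtain ⟨R', hR'def⟩ : ∃ R', R' = R \ {p.1, (yR p).1} := ⟨_, rfl⟩
  rw [← hR'def] at hsub hcard' hτ'
  have h0R' : p₀.1 ∉ R' := fun h => h0R (hsub h)
  have h1R' : p₁.1 ∉ R' := fun h => h1R (hsub h)
  have h2R' : p₂.1 ∉ R' := fun h => h2R (hsub h)
  have hcR' : c ∉ R' := fun h => hcR (hsub h)
  obtain ⟨k, hk⟩ : ∃ k : ι × ℤˣ, k.1 = c := ⟨(c, 1), rfl⟩
  subst hk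
  have hz₁ := hτ.mul_signedSwap h0R h1R h01
  have hz₂ := (hτ'.mul_signedSwap h0R' h1R' h01).mul_signedSwap (p := p₂) (q := k)
    (by simp [*, h12.symm, hcd.symm]) (by simp [*, h1c.symm]) hcd.symm
  have hz₃ := (hτ'.mul_signedSwap (p := p₀) (q := k) h0R' hcR' hcd'.symm).mul_signedSwap
    (p := p₁) (q := p₂) (by simp [*, h01.symm]) (by simp [*, hcd.symm]) h12
  have hkey := commute_signedSwap_mul h01 hcd'.symm hdd'.symm h1c h12 hcd
  refine ⟨_, _, _, _, _, _, ⟨hz₁, ?_⟩, ⟨hz₂, ?_⟩, ⟨hz₃, ?_⟩, ?_, ?_, ?_, ?_⟩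
  · rw [Finset.card_insert_of_notMem (by simp [*]), Finset.card_insert_of_notMem (by simp [*])]
    omega
  · rw [Finset.card_insert_of_notMem (by simp [*, hcd.symm, h12.symm]),
      Finset.card_insert_of_notMem (by simp [*, h1c.symm]),
      Finset.card_insert_of_notMem (by simp [*]), Finset.card_insert_of_notMem (by simp [*])]
    omega
  · rw [Finset.card_insert_of_notMem (by simp [*, h01.symm]),
      Finset.card_insert_of_notMem (by simp [*, hcd.symm]),
      Finset.card_insert_of_notMem (by simp [*, hcd'.symm]),
      Finset.card_insert_of_notMem (by simp [*])]
    omega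
  · rw [hxe]
    exact (hτx.mul_right (hτ.commute_signedSwap_of_notMem h0R h1R)).mul_left
      ((hxR.commute_signedSwap_of_notMem h0R h1R).symm.mul_right (Commute.refl _))
  · refine Commute.mul_left (Commute.mul_left ?_ ?_) ?_ <;> refine Commute.mul_right ?_ ?_
    · exact hτ'τ
    · exact hτ'.commute_signedSwap_of_notMem h0R' h1R'
    · exact (hτ.commute_signedSwap_of_notMem h0R h1R).symm
    · exact Commute.refl _
    · exact (hτ.commute_signedSwap_of_notMem h2R hcR).symm
    · exact commute_signedSwap_signedSwap hdd' h12.symm hcd' h1c.symm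
  · rw [mul_assoc, mul_assoc]
    refine Commute.mul_left (Commute.mul_right (Commute.refl _) ?_) (Commute.mul_right ?_ ?_)
    · exact (hτ'.commute_signedSwap_of_notMem h0R' hcR').mul_right
        (hτ'.commute_signedSwap_of_notMem h1R' h2R')
    · exact ((hτ'.commute_signedSwap_of_notMem h0R' h1R').mul_right
        (hτ'.commute_signedSwap_of_notMem h2R' hcR')).symm
    · rwa [signedSwap_comm p₂ k]
  · rw [hye]
    refine Commute.mul_left (Commute.mul_left ?_ ?_) ?_ <;> refine Commute.mul_right ?_ ?_
    · exact hτ'y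
    · exact hτ'.commute_signedSwap_of_notMem h1R' h2R'
    · exact (hyR.commute_signedSwap_of_notMem h0R hcR).symm
    · exact commute_signedSwap_signedSwap h01 hdd'.symm h1c.symm hcd
    · exact (hyR.commute_signedSwap_of_notMem h1R h2R).symm
    · exact Commute.refl _

lemma hasChain_of_path_four (hx : IsSignedMatching x S)
    (hy : IsSignedMatching y S') [Fintype ι] (hS : S = Finset.univ \ {c, d})
    (hS' : S' = Finset.univ \ {c, d'})
    (hcd : c ≠ d) (hcd' : c ≠ d') (hdd' : d ≠ d') {p₀ p₁ p₂ p₃ p₄ : ι × ℤˣ} (h₀ : p₀.1 = d')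
    (h₁ : x p₀ = p₁) (h₂ : y p₁ = p₂) (h₃ : x p₂ = p₃) (h₄ : y p₃ = p₄) (h2d : p₂.1 ≠ d)
    (hd : p₄.1 = d) : HasChain S.card x y := by
  subst h₀ hd
  have hSmem : ∀ i, i ∈ S ↔ i ≠ c ∧ i ≠ p₄.1 := by simp [hS]
  have hS'mem : ∀ i, i ∈ S' ↔ i ≠ c ∧ i ≠ p₀.1 := by simp [hS']
  have h0S : p₀.1 ∈ S := (hSmem _).2 ⟨hcd'.symm, hdd'.symm⟩
  have h1S : p₁.1 ∈ S := h₁ ▸ (hx.preserves_support _).2 h0S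
  have h01 : p₀.1 ≠ p₁.1 := h₁ ▸ (hx.fst_ne p₀ h0S).symm
  have h1c := ((hSmem _).1 h1S).1
  have h14 := ((hSmem _).1 h1S).2
  have h1S' : p₁.1 ∈ S' := (hS'mem _).2 ⟨h1c, h01.symm⟩
  have h2S' : p₂.1 ∈ S' := h₂ ▸ (hy.preserves_support _).2 h1S'
  have h12 : p₁.1 ≠ p₂.1 := h₂ ▸ (hy.fst_ne p₁ h1S').symm
  have h2c := ((hS'mem _).1 h2S').1
  have h20 := ((hS'mem _).1 h2S').2
  have h2S : p₂.1 ∈ S := (hSmem _).2 ⟨h2c, h2d⟩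
  have h3S : p₃.1 ∈ S := h₃ ▸ (hx.preserves_support _).2 h2S
  have h23 : p₂.1 ≠ p₃.1 := h₃ ▸ (hx.fst_ne p₂ h2S).symm
  have h3c := ((hSmem _).1 h3S).1
  have h34 := ((hSmem _).1 h3S).2
  have h31 : p₃.1 ≠ p₁.1 := fun e => by
    rw [← h₃, ← h₁] at e
    exact h20 (fst_eq_of_fst_apply_eq hx.commute_signFlip e)
  have h30 : p₃.1 ≠ p₀.1 := fun e => by
    have := hx.fst_congr e
    rw [← h₃, hx.apply_apply, h₁] at this
    exact h12 this.symm
  have h3S' : p₃.1 ∈ S' := (hS'mem _).2 ⟨h3c, h30⟩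
  have := h01.symm
  have := h12.symm
  have := h14.symm
  have := h1c.symm
  have := h20.symm
  have := h2c.symm
  have := h2d.symm
  have := h23.symm
  have := h30.symm
  have := h31.symm
  have := h34.symm
  have := h3c.symm
  have := hcd.symm
  have := hcd'.symm
  have := hdd'.symm
  obtain ⟨xA, hxA, hxe⟩ := hx.exists_eq_mul_signedSwap h0S h₁
  obtain ⟨yA, hyA, hye⟩ := hy.exists_eq_mul_signedSwap h1S' h₂
  have hxA2 : xA p₂ = p₃ := by
    rw [← h₃, hxe, Equiv.Perm.mul_apply, signedSwap_of_ne h20 h12.symm]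
  have hyA3 : yA p₃ = p₄ := by
    rw [← h₄, hye, Equiv.Perm.mul_apply, signedSwap_of_ne h31 h23.symm]
  obtain ⟨xR, hxR, hxAe⟩ := hxA.exists_eq_mul_signedSwap (by simp [*]) hxA2
  obtain ⟨yR, hyR, hyAe⟩ := hyA.exists_eq_mul_signedSwap (by simp [*]) hyA3
  rw [hxAe] at hxe
  rw [hyAe] at hye
  obtain ⟨R, hR⟩ : ∃ R, R = (S \ {p₀.1, p₁.1}) \ {p₂.1, p₃.1} := ⟨_, rfl⟩
  have hR' : (S' \ {p₁.1, p₂.1}) \ {p₃.1, p₄.1} = R := by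
    ext i
    simp only [hR, Finset.mem_sdiff, hSmem, hS'mem, Finset.mem_insert, Finset.mem_singleton]
    tauto
  rw [← hR] at hxR
  rw [hR'] at hyR
  have h0R : p₀.1 ∉ R := by simp [hR]
  have h1R : p₁.1 ∉ R := by simp [hR]
  have h2R : p₂.1 ∉ R := by simp [hR]
  have h3R : p₃.1 ∉ R := by simp [hR]
  have h4R : p₄.1 ∉ R := by simp [hR, hSmem]
  have hcR : c ∉ R := by simp [hR, hSmem]
  have hcard : R.card + 4 = S.card := by
    have e1 := Finset.card_sdiff_add_card_eq_card
      (Finset.insert_subset h0S (Finset.singleton_subset_iff.2 h1S))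
    have e2 := Finset.card_sdiff_add_card_eq_card (s := {p₂.1, p₃.1}) (t := S \ {p₀.1, p₁.1})
      (Finset.insert_subset (by simp [*]) (Finset.singleton_subset_iff.2 (by simp [*])))
    rw [Finset.card_pair h01] at e1
    rw [Finset.card_pair h23, ← hR] at e2
    omega
  rw [hxe, hye, ← hcard]
  exact hxR.hasChain_mul_signedSwap hyR (c := (c, 1)) (by simp [*]) (by simp [*])

lemma hasChain_of_two_fixed [Fintype ι] (h5 : 5 ≤ Fintype.card ι) (hx : IsSignedMatching x S)
    (hy : IsSignedMatching y S') (hS : S = Finset.univ \ {c, d}) (hS' : S' = Finset.univ \ {c, d'})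
    (hcd : c ≠ d) (hcd' : c ≠ d') (hdd' : d ≠ d') : HasChain S.card x y := by
  have hSmem : ∀ i, i ∈ S ↔ i ≠ c ∧ i ≠ d := by simp [hS]
  have hS'mem : ∀ i, i ∈ S' ↔ i ≠ c ∧ i ≠ d' := by simp [hS']
  obtain ⟨p, rfl⟩ : ∃ p : ι × ℤˣ, p.1 = d' := ⟨(d', 1), rfl⟩
  obtain ⟨q, rfl⟩ : ∃ q : ι × ℤˣ, q.1 = d := ⟨(d, 1), rfl⟩
  by_cases h2 : (y (x p)).1 = q.1
  · exact hx.hasChain_of_path_two h5 hy hS hS' hcd hcd' hdd' rfl rfl rfl h2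
  by_cases h4 : (y (x (y (x p)))).1 = q.1
  · exact hx.hasChain_of_path_four hy hS hS' hcd hcd' hdd' rfl rfl rfl rfl rfl h2 h4
  have hpS : p.1 ∈ S := (hSmem _).2 ⟨hcd'.symm, hdd'.symm⟩
  have hqS' : q.1 ∈ S' := (hS'mem _).2 ⟨hcd.symm, hdd'⟩
  have h1S : (x p).1 ∈ S := (hx.preserves_support p).2 hpS
  have h1S' : (x p).1 ∈ S' := (hS'mem _).2 ⟨((hSmem _).1 h1S).1, hx.fst_ne p hpS⟩
  have h2S' : (y (x p)).1 ∈ S' := (hy.preserves_support _).2 h1S'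
  have h2S : (y (x p)).1 ∈ S := (hSmem _).2 ⟨((hS'mem _).1 h2S').1, h2⟩
  have g1S' : (y q).1 ∈ S' := (hy.preserves_support q).2 hqS'
  have g1S : (y q).1 ∈ S := (hSmem _).2 ⟨((hS'mem _).1 g1S').1, hy.fst_ne q hqS'⟩
  have g2S : (x (y q)).1 ∈ S := (hx.preserves_support _).2 g1S
  have g2 : (x (y q)).1 ≠ p.1 := fun e => h2 (by
    have := hx.fst_congr e
    rw [hx.apply_apply] at this
    have := hy.fst_congr this
    rw [hy.apply_apply] at this
    exact this.symm)
  have g2S' : (x (y q)).1 ∈ S' := (hS'mem _).2 ⟨((hSmem _).1 g2S).1, g2⟩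
  have hsub : ∀ {a b : ι} {B : Finset ι}, a ∈ B → b ∈ B → ({a, b} : Finset ι) ⊆ B := by
    intro a b B ha hb k
    simp only [Finset.mem_insert, Finset.mem_singleton]
    rintro (rfl | rfl) <;> assumption
  have d1 : (x p).1 ≠ (y q).1 := fun e => h2 (by
    have := hy.fst_congr e
    rwa [hy.apply_apply] at this)
  have d2 : (x p).1 ≠ (x (y q)).1 := fun e =>
    ((hS'mem _).1 g1S').2 (fst_eq_of_fst_apply_eq hx.commute_signFlip e).symm
  have d3 : (y (x p)).1 ≠ (y q).1 := fun e =>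
    ((hSmem _).1 h1S).2 (fst_eq_of_fst_apply_eq hy.commute_signFlip e)
  have d4 : (y (x p)).1 ≠ (x (y q)).1 := fun e => h4 (by
    have := hx.fst_congr e
    rw [hx.apply_apply] at this
    have := hy.fst_congr this
    rwa [hy.apply_apply] at this)
  have hdisj : Disjoint ({(y q).1, (x (y q)).1} : Finset ι) {(x p).1, (y (x p)).1} := by
    simp [d1, d2, d3, d4]
  have hcf : ({(x p).1, (y (x p)).1} : Finset ι).card = 2 :=
    Finset.card_pair (hy.fst_ne _ h1S').symm
  have hce : ({(y q).1, (x (y q)).1} : Finset ι).card = 2 :=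
    Finset.card_pair (hx.fst_ne _ g1S).symm
  obtain ⟨z₁, h₁, hz₁, hp₁⟩ := hx.exists_commute_compl hcd hS (hsub g1S g2S) (hsub h1S h2S)
    hdisj hcf (hx.preserves_pair rfl)
  obtain ⟨z₃, h₃, hz₃, hp₃⟩ := hy.exists_commute_compl hcd' hS' (hsub h1S' h2S')
    (hsub g1S' g2S') hdisj.symm hce (hy.preserves_pair rfl)
  have hcard : (Finset.univ \ {(y q).1, (x (y q)).1} : Finset ι).card = S.card := by
    rw [hS, Finset.card_sdiff_of_subset (Finset.subset_univ _),
      Finset.card_sdiff_of_subset (Finset.subset_univ _), hce, Finset.card_pair hcd]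
  rw [← hcard]
  refine h₁.hasChain_of_preserves h₃ ?_ hz₁ hz₃ hp₁ hp₃
  rw [Finset.card_sdiff_of_subset (Finset.subset_univ _),
    Finset.card_sdiff_of_subset (Finset.subset_univ _), hce, hcf]

end TwoFixed

/-- Any two signed matchings with supports of the same size missing at least two points are joined
by a chain. -/
theorem hasChain [Fintype ι] (h5 : 5 ≤ Fintype.card ι) (hx : IsSignedMatching x S)
    (hy : IsSignedMatching y S') (hc : S'.card = S.card) (hle : S.card + 2 ≤ Fintype.card ι) :
    HasChain S.card x y := by
  by_cases heven : Even (S ∩ S').card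
  · exact hx.hasChain_of_even hy hc heven
  by_cases hpair : ∃ c d, c ≠ d ∧ c ∉ S ∧ d ∉ S ∧ (c ∈ S' ↔ d ∈ S')
  · obtain ⟨c, d, hcd, hcS, hdS, h⟩ := hpair
    exact hx.hasChain_of_odd hy hc heven hcd hcS hdS h
  push Not at hpair
  have hSc : Sᶜ.card + S.card = Fintype.card ι := Finset.card_compl_add_card S
  have hS'c : S'ᶜ.card + S'.card = Fintype.card ι := Finset.card_compl_add_card S'
  have hcases : ∃ c d, c ∉ S ∧ d ∉ S ∧ c ∉ S' ∧ d ∈ S' ∧ c ≠ d := by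
    obtain ⟨a, ha, b, hb, hab⟩ := Finset.one_lt_card.1 (by omega : 1 < Sᶜ.card)
    rw [Finset.mem_compl] at ha hb
    rcases hpair a b hab ha hb with h | h
    · exact ⟨b, a, hb, ha, h.2, h.1, hab.symm⟩
    · exact ⟨a, b, ha, hb, h.1, h.2, hab⟩
  obtain ⟨c, d, hcS, hdS, hcS', hdS', hcd⟩ := hcases
  have hS : S = Finset.univ \ {c, d} := by
    ext i
    simp only [Finset.mem_sdiff, Finset.mem_univ, true_and, Finset.mem_insert,
      Finset.mem_singleton, not_or]
    refine ⟨fun h => ⟨fun e => hcS (e ▸ h), fun e => hdS (e ▸ h)⟩, fun h => ?_⟩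
    by_contra hi
    have h1 := hpair i c h.1 hi hcS
    have h2 := hpair i d h.2 hi hdS
    tauto
  have hScard : Sᶜ.card = 2 := by
    rw [hS, ← Finset.compl_eq_univ_sdiff, compl_compl, Finset.card_pair hcd]
  obtain ⟨d', hd', hd'c⟩ := Finset.exists_mem_ne (by omega : 1 < S'ᶜ.card) c
  have hS' : S' = Finset.univ \ {c, d'} := by
    rw [← Finset.compl_eq_univ_sdiff, eq_compl_comm, eq_comm]
    refine (Finset.eq_of_subset_of_card_le ?_ ?_).symm
    · intro k
      simp only [Finset.mem_insert, Finset.mem_singleton]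
      rintro (rfl | rfl)
      · simpa using hcS'
      · exact hd'
    · rw [Finset.card_pair hd'c.symm]
      omega
  refine hx.hasChain_of_two_fixed h5 hy hS hS' hcd hd'c.symm ?_
  rintro rfl
  exact Finset.mem_compl.1 hd' hdS'

end IsSignedMatching

end ChainTheorem

namespace AffineWeylC

variable {n : ℕ} {a b c g h : AffineWeylC n}

lemma perm_apply_inv (f : Equiv.Perm (Fin n)) (i : Fin n) : f (f⁻¹ i) = i :=
  f.apply_symm_apply i

lemma perm_inv_apply (f : Equiv.Perm (Fin n)) (i : Fin n) : f⁻¹ (f i) = i :=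
  f.symm_apply_apply i

lemma pi_inv_eq (hg : g * g = 1) : g.π⁻¹ = g.π :=
  inv_eq_of_mul_eq_one_right (congrArg AffineWeylC.π hg)

lemma pi_pi (hg : g * g = 1) (i : Fin n) : g.π (g.π i) = i :=
  congrArg (fun f : Equiv.Perm (Fin n) => f i) (congrArg AffineWeylC.π hg)

lemma s_pi (hg : g * g = 1) (i : Fin n) : g.s (g.π i) = g.s i := by
  have h : g.s i * g.s (g.π i) = 1 := congrFun (congrArg AffineWeylC.s hg) i
  rw [← one_mul (g.s (g.π i)), ← Int.units_mul_self (g.s i), mul_assoc, h, mul_one]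

lemma v_pi (hg : g * g = 1) (i : Fin n) : g.v (g.π i) = -(g.s i : ℤ) * g.v i := by
  have h : (g.s (g.π⁻¹ (g.π i)) : ℤ) * g.v (g.π⁻¹ (g.π i)) + g.v (g.π i) = 0 :=
    congrFun (congrArg AffineWeylC.v hg) (g.π i)
  rw [perm_inv_apply] at h
  linear_combination h

/-- Elements of order dividing two, with exactly `k` points moved and no negative fixed point. -/
structure IsPositive (g : AffineWeylC n) (k : ℕ) : Prop where
  mul_self : g * g = 1
  s_of_fixed : ∀ i, g.π i = i → g.s i = 1
  card_support : g.π.support.card = k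

lemma IsPositive.of_isConj {k : ℕ} (hg : g.IsPositive k) (hgh : IsConj g h) : h.IsPositive k := by
  obtain ⟨c, rfl⟩ := isConj_iff.1 hgh
  refine ⟨?_, fun i hi => ?_, ?_⟩
  · rw [show c * g * c⁻¹ * (c * g * c⁻¹) = c * (g * g) * c⁻¹ by group, hg.mul_self]
    simp
  · have hc : c.π⁻¹ (g.π (c.π i)) = i := hi
    rw [Equiv.Perm.inv_eq_iff_eq] at hc
    have h1 := hg.s_of_fixed _ hc
    simp [h1, hc]
  · rw [← hg.card_support]
    simpa [mul_assoc] using Equiv.Perm.card_support_conj (σ := c.π⁻¹) (τ := g.π)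

lemma isConj_translation (p : Fin n → ℤ)
    (hv : ∀ i, g.v i = p i - (g.s (g.π⁻¹ i) : ℤ) * p (g.π⁻¹ i)) :
    IsConj ⟨g.π, g.s, 0⟩ g := by
  refine (isConj_iff.2 ⟨⟨1, 1, p⟩, ?_⟩ : IsConj g ⟨g.π, g.s, 0⟩).symm
  rw [mul_inv_eq_iff_eq_mul]
  refine AffineWeylC.ext ?_ (funext fun j => ?_) (funext fun i => ?_)
  · simp
  · simp
  · simp [hv]

/-- A shift centering the involution `g`. -/
lemma exists_center (hg : g * g = 1) (hs : ∀ i, g.π i = i → g.s i = 1) :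
    ∃ p : Fin n → ℤ, ∀ i, g.v i = p i - (g.s (g.π⁻¹ i) : ℤ) * p (g.π⁻¹ i) := by
  refine ⟨fun i => if i < g.π i then g.v i else 0, fun i => ?_⟩
  have hv := v_pi hg i
  simp only [pi_inv_eq hg, pi_pi hg, s_pi hg]
  rcases lt_trichotomy i (g.π i) with h | h | h
  · simp [h, h.not_gt]
  · have h1 := hs i h.symm
    rw [← h, h1] at hv
    simp only [← h, lt_self_iff_false, if_false]
    push_cast at hv
    linarith
  · simp only [h, h.not_gt, if_true, if_false, hv]
    have h2 : (g.s i : ℤ) * (g.s i : ℤ) = 1 := by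
      rw [← Units.val_mul, Int.units_mul_self, Units.val_one]
    linear_combination (-(g.v i)) * h2

lemma isConj_pos (hg : g * g = 1) (hs : ∀ i, g.π i = i → g.s i = 1) :
    IsConj ⟨g.π, g.s, 0⟩ (⟨g.π, 1, 0⟩ : AffineWeylC n) := by
  refine isConj_iff.2 ⟨⟨1, fun i => if i < g.π i then 1 else g.s i, 0⟩, ?_⟩
  rw [mul_inv_eq_iff_eq_mul]
  refine AffineWeylC.ext ?_ (funext fun j => ?_) (funext fun i => ?_)
  · simp
  · simp only [mul_s, Equiv.Perm.one_apply, Pi.one_apply, one_mul, pi_pi hg, s_pi hg]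
    rcases lt_trichotomy j (g.π j) with h | h | h
    · simp [h, h.not_gt]
    · simp [← h, hs j h.symm]
    · simp [h, h.not_gt]
  · simp

lemma isConj_of_pi (hgh : IsConj g.π h.π) :
    IsConj (⟨g.π, 1, 0⟩ : AffineWeylC n) ⟨h.π, 1, 0⟩ := by
  obtain ⟨σ, hσ⟩ := isConj_iff.1 hgh
  refine isConj_iff.2 ⟨⟨σ⁻¹, 1, 0⟩, ?_⟩
  rw [mul_inv_eq_iff_eq_mul]
  refine AffineWeylC.ext ?_ (funext fun j => ?_) (funext fun i => ?_)
  · simp [← hσ, mul_assoc]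
  · simp
  · simp

lemma IsPositive.isConj {k : ℕ} (hg : g.IsPositive k) (hh : h.IsPositive k) : IsConj g h := by
  have key : ∀ f : AffineWeylC n, f.IsPositive k →
      IsConj f ⟨f.π, 1, 0⟩ ∧ f.π.cycleType = Multiset.replicate (k / 2) 2 := by
    intro f hf
    obtain ⟨p, hp⟩ := exists_center hf.mul_self hf.s_of_fixed
    refine ⟨(isConj_translation p hp).symm.trans (isConj_pos hf.mul_self hf.s_of_fixed), ?_⟩
    have h2 := (Equiv.Perm.pow_prime_eq_one_iff (σ := f.π) (p := 2)).1 (by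
      rw [sq]
      exact congrArg AffineWeylC.π hf.mul_self)
    have h3 := Multiset.eq_replicate_card.2 h2
    have h4 := Equiv.Perm.sum_cycleType f.π
    rw [h3, Multiset.sum_replicate, hf.card_support, smul_eq_mul] at h4
    rw [h3, ← h4, Nat.mul_div_cancel _ two_pos]
  obtain ⟨hg1, hg2⟩ := key g hg
  obtain ⟨hh1, hh2⟩ := key h hh
  exact hg1.trans ((isConj_of_pi (Equiv.Perm.isConj_iff_cycleType_eq.2 (hg2.trans hh2.symm))).trans
    hh1.symm)

lemma isPositive_of_hasType {m l : ℕ} (hg : g * g = 1) (ht : g.HasType m 0 0 l)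
    (hsum : 2 * m + l = n) : g.IsPositive (2 * m) := by
  obtain ⟨-, he, ho, hp⟩ := ht
  have hs : ∀ i, g.π i = i → g.s i = 1 := by
    intro i hi
    rcases Int.units_eq_one_or (g.s i) with h | h
    · exact h
    rw [numNegEven, Set.ncard_eq_zero] at he
    rw [numNegOdd, Set.ncard_eq_zero] at ho
    rcases Int.even_or_odd (g.v i) with hv | hv
    · exact (Set.eq_empty_iff_forall_notMem.1 he i ⟨hi, h, hv⟩).elim
    · exact (Set.eq_empty_iff_forall_notMem.1 ho i ⟨hi, h, hv⟩).elim
  refine ⟨hg, hs, ?_⟩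
  have h1 : ({i : Fin n | g.π i = i ∧ g.s i = 1} : Set (Fin n)) = ↑(g.π.supportᶜ) := by
    ext i
    simp only [Set.mem_ofPred_eq, Finset.coe_compl, Set.mem_compl_iff, Finset.mem_coe,
      Equiv.Perm.mem_support, not_not]
    exact ⟨And.left, fun h => ⟨h, hs i h⟩⟩
  rw [numPos, h1, Set.ncard_coe_finset] at hp
  have h2 := Finset.card_compl_add_card g.π.support
  rw [Fintype.card_fin] at h2
  omega

/-- The affine element `g` is the conjugate of the signed permutation `x` by the translation
by `p`. -/
structure Represents (p : Fin n → ℤ) (x : Equiv.Perm (Fin n × ℤˣ)) (g : AffineWeylC n) :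
    Prop where
  apply_eq : ∀ ω, x ω = (g.π ω.1, ω.2 * g.s ω.1)
  v_eq : ∀ i, g.v i = p i - (g.s (g.π⁻¹ i) : ℤ) * p (g.π⁻¹ i)

variable {p q : Fin n → ℤ} {x y z : Equiv.Perm (Fin n × ℤˣ)} {S : Finset (Fin n)}

lemma represents_one : Represents p (1 : Equiv.Perm (Fin n × ℤˣ)) 1 :=
  ⟨fun ω => by simp, fun i => by simp⟩

lemma Represents.mul (hg : Represents p x g) (hh : Represents p y h) :
    Represents p (y * x) (g * h) := by
  refine ⟨fun ω => ?_, fun i => ?_⟩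
  · simp [hg.apply_eq, hh.apply_eq, mul_assoc]
  · simp only [mul_v, hg.v_eq, hh.v_eq, mul_s, mul_π, mul_inv_rev, Equiv.Perm.mul_apply,
      perm_apply_inv, Units.val_mul]
    ring

lemma Represents.unique (hg : Represents p x g) (hh : Represents p x h) : g = h := by
  have h1 : g.π = h.π := Equiv.ext fun i => by
    have := (hg.apply_eq (i, 1)).symm.trans (hh.apply_eq (i, 1))
    exact congrArg Prod.fst this
  have h2 : g.s = h.s := funext fun i => by
    have := (hg.apply_eq (i, 1)).symm.trans (hh.apply_eq (i, 1))
    simpa using congrArg Prod.snd this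
  exact AffineWeylC.ext h1 h2 (funext fun i => by rw [hg.v_eq, hh.v_eq, h1, h2])

lemma Represents.commute (hg : Represents p x g) (hh : Represents p y h) (hxy : Commute x y) :
    Commute g h :=
  (hg.mul hh).unique (hxy.eq ▸ hh.mul hg)

lemma Represents.mul_self (hg : Represents p x g) (hx : IsSignedMatching x S) : g * g = 1 :=
  (hg.mul hg).unique (hx.mul_self ▸ represents_one)

lemma Represents.pi_eq_iff (hg : Represents p x g) (hx : IsSignedMatching x S) (i : Fin n) :
    g.π i = i ↔ i ∉ S := by
  have h1 := hg.apply_eq (i, 1)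
  refine ⟨fun h hi => hx.fst_ne (i, 1) hi (by rw [h1]; exact h), fun hi => ?_⟩
  rw [hx.apply_of_notMem _ hi] at h1
  exact (congrArg Prod.fst h1).symm

lemma Represents.s_of_fixed (hg : Represents p x g) (hx : IsSignedMatching x S) (i : Fin n)
    (hi : g.π i = i) : g.s i = 1 := by
  have h1 := hg.apply_eq (i, 1)
  rw [hx.apply_of_notMem _ ((hg.pi_eq_iff hx i).1 hi)] at h1
  simpa using (congrArg Prod.snd h1).symm

lemma Represents.isPositive (hg : Represents p x g) (hx : IsSignedMatching x S) :
    g.IsPositive S.card := by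
  refine ⟨hg.mul_self hx, hg.s_of_fixed hx, congrArg Finset.card ?_⟩
  ext i
  rw [Equiv.Perm.mem_support, Ne, hg.pi_eq_iff hx, not_not]

lemma exists_represents (p : Fin n → ℤ) (hx : IsSignedMatching x S) :
    ∃ g, Represents p x g := by
  have hinv : Function.Involutive fun i : Fin n => (x (i, 1)).1 := fun i => by
    have h1 : (x ((x (i, 1)).1, 1)).1 = (x (x (i, 1))).1 := hx.fst_congr rfl
    exact h1.trans (congrArg Prod.fst (hx.apply_apply _))
  refine ⟨⟨hinv.toPerm, fun i => (x (i, 1)).2, fun i => p i - ((x (hinv.toPerm⁻¹ i, 1)).2 : ℤ) *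
    p (hinv.toPerm⁻¹ i)⟩, fun ω => ?_, fun i => rfl⟩
  obtain ⟨i, e⟩ := ω
  show x (i, e) = ((x (i, 1)).1, e * (x (i, 1)).2)
  rcases Int.units_eq_one_or e with rfl | rfl
  · simp
  · have := hx.apply_signFlip (i, 1)
    simpa using this

lemma IsPositive.exists_represents {k : ℕ} (hg : g.IsPositive k) :
    ∃ p x S, IsSignedMatching x S ∧ S.card = k ∧ Represents p x g := by
  obtain ⟨p, hp⟩ := exists_center hg.mul_self hg.s_of_fixed
  have hinv : Function.Involutive fun ω : Fin n × ℤˣ => (g.π ω.1, ω.2 * g.s ω.1) := fun ω => by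
    simp [pi_pi hg.mul_self, s_pi hg.mul_self, mul_assoc]
  refine ⟨p, hinv.toPerm, g.π.support, ⟨hinv, fun ω => ?_, fun ω hω => ?_, fun ω hω => ?_⟩,
    hg.card_support, fun ω => rfl, hp⟩
  · simp
  · rw [Equiv.Perm.notMem_support] at hω
    simp [hω, hg.s_of_fixed]
  · exact Equiv.Perm.mem_support.1 hω

lemma commute_of_s_eq_neg (hg : g * g = 1) (hh : h * h = 1) (hπ : h.π = g.π)
    (hgs : ∀ i, g.π i = i → g.s i = 1) (hhs : ∀ i, g.π i = i → h.s i = 1)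
    (hs : ∀ i, g.π i ≠ i → h.s i = -g.s i) : Commute g h := by
  have hgv := v_pi hg
  have hhv := v_pi hh
  have hgp := s_pi hg
  have hhp := s_pi hh
  refine AffineWeylC.ext (by simp [hπ]) (funext fun j => ?_) (funext fun i => ?_)
  · simp only [mul_s, hπ] at *
    rw [hgp, hhp, mul_comm]
  · simp only [mul_v, hπ, pi_inv_eq hg] at *
    rw [hgp, hhp, hgv, hhv]
    by_cases hi : g.π i = i
    · have h1 := hgv i
      have h2 := hhv i
      rw [hi, hgs i hi] at h1
      rw [hi, hhs i hi] at h2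
      push_cast at h1 h2
      have h3 : g.v i = 0 := by linarith
      have h4 : h.v i = 0 := by linarith
      simp [h3, h4]
    · have h2 : (g.s i : ℤ) * (g.s i : ℤ) = 1 := by
        rw [← Units.val_mul, Int.units_mul_self, Units.val_one]
      rw [hs i hi]
      push_cast
      linear_combination (g.v i - h.v i) * h2

end AffineWeylC

/-- Changing all the signs on the support of a signed matching gives a signed matching commuting
with everything the former one commutes with. -/
lemma IsSignedMatching.exists_neg {ι : Type*} {S : Finset ι} {z : Equiv.Perm (ι × ℤˣ)}
    (hz : IsSignedMatching z S) : ∃ z', IsSignedMatching z' S ∧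
      (∀ ω, ω.1 ∈ S → z' ω = signFlip ι (z ω)) ∧
      ∀ y T, IsSignedMatching y T → Commute z y → Commute z' y := by
  classical
  have hS := hz.preserves_support
  let f : ι × ℤˣ → ι × ℤˣ := fun ω => if ω.1 ∈ S then signFlip ι (z ω) else ω
  have hf1 : ∀ ω, ω.1 ∈ S → f ω = signFlip ι (z ω) := fun ω h => if_pos h
  have hf2 : ∀ ω, ω.1 ∉ S → f ω = ω := fun ω h => if_neg h
  have hf : Function.Involutive f := by
    intro ω
    by_cases h : ω.1 ∈ S
    · rw [hf1 ω h, hf1 (signFlip ι (z ω)) ((hS ω).2 h), hz.apply_signFlip, hz.apply_apply]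
      simp
    · rw [hf2 ω h, hf2 ω h]
  refine ⟨hf.toPerm, ⟨hf, fun ω => ?_, hf2, fun ω hω => ?_⟩, hf1, fun y T hy hc => ?_⟩
  · show f (signFlip ι ω) = signFlip ι (f ω)
    by_cases h : ω.1 ∈ S
    · rw [hf1 ω h, hf1 (signFlip ι ω) h, hz.apply_signFlip]
    · rw [hf2 ω h, hf2 (signFlip ι ω) h]
  · show (f ω).1 ≠ ω.1
    rw [hf1 ω hω]
    exact hz.fst_ne ω hω
  · rw [commute_iff_apply] at hc ⊢
    have hyS : Preserves y S := hy.preserves_of_imp fun ω hω => by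
      by_contra h
      have h1 := hc ω
      rw [hz.apply_of_notMem _ h] at h1
      exact hz.fst_ne ω hω (congrArg Prod.fst (y.injective h1)).symm
    intro ω
    show f (y ω) = y (f ω)
    by_cases h : ω.1 ∈ S
    · rw [hf1 ω h, hf1 _ ((hyS ω).2 h), hc, hy.apply_signFlip]
    · rw [hf2 ω h, hf2 _ (fun h' => h ((hyS ω).1 h'))]

namespace AffineWeylC

variable {n : ℕ} {g h : AffineWeylC n} {p q : Fin n → ℤ} {x y z z' : Equiv.Perm (Fin n × ℤˣ)}
  {S : Finset (Fin n)}

lemma Represents.commute_neg (hg : Represents p z g) (hh : Represents q z' h)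
    (hz : IsSignedMatching z S) (hz' : IsSignedMatching z' S)
    (h' : ∀ ω, ω.1 ∈ S → z' ω = signFlip _ (z ω)) : Commute g h := by
  have key : ∀ i ∈ S, h.π i = g.π i ∧ h.s i = -g.s i := by
    intro i hi
    have h1 := h' (i, 1) hi
    rw [hg.apply_eq, hh.apply_eq] at h1
    simpa using h1
  have hπ : h.π = g.π := Equiv.ext fun i => by
    by_cases hi : i ∈ S
    · exact (key i hi).1
    · rw [(hg.pi_eq_iff hz i).2 hi, (hh.pi_eq_iff hz' i).2 hi]
  refine commute_of_s_eq_neg (hg.mul_self hz) (hh.mul_self hz') hπ (hg.s_of_fixed hz)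
    (fun i hi => hh.s_of_fixed hz' i (hπ ▸ hi)) fun i hi => ?_
  rw [Ne, hg.pi_eq_iff hz, not_not] at hi
  exact (key i hi).2

end AffineWeylC

lemma commGraph_edist_le_add_one {G : Type*} [Group G] {X : Set G} {u v w : X} {k : ℕ∞}
    (h : (commGraph X).edist u v ≤ k) (hc : Commute (v : G) w) :
    (commGraph X).edist u w ≤ k + 1 := by
  refine (SimpleGraph.edist_triangle (v := v)).trans (add_le_add h ?_)
  rw [SimpleGraph.edist_le_one_iff_adj_or_eq]
  by_cases hvw : v = w
  · exact Or.inr hvw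
  · exact Or.inl ⟨fun e => hvw (Subtype.ext e), hc⟩

/-- Suppose `k_e = k_o = 0`.  If `2m = n` the diameter is at
most 3; if `n ≥ 5` and `l ≥ 2` the diameter is at most 5. -/
theorem stmt_12 (n m l : ℕ) (a : AffineWeylC n) (ha : a.Involution)
    (htype : a.HasType m 0 0 l) (hsum : 2 * m + l = n)
    (X : Set (AffineWeylC n)) (hX : X = AffineWeylC.conjClass a) :
    (2 * m = n → (commGraph X).ediam ≤ 3) ∧
    (5 ≤ n → 2 ≤ l → (commGraph X).ediam ≤ 5) := by
  subst hX
  have hpos := AffineWeylC.isPositive_of_hasType ha.2 htype hsum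
  have hmem : ∀ {p x S} {g : AffineWeylC n}, IsSignedMatching x S → S.card = 2 * m →
      AffineWeylC.Represents p x g → g ∈ AffineWeylC.conjClass a := fun hx hS hg =>
    hpos.isConj (hS ▸ hg.isPositive hx)
  refine ⟨fun hm => ?_, fun h5 hl => ?_⟩
  all_goals
    refine SimpleGraph.ediam_le_of_edist_le ?_
    rintro ⟨b, hb⟩ ⟨c, hc⟩
    obtain ⟨p, x, S, hx, hS, hbx⟩ := (hpos.of_isConj hb).exists_represents
    obtain ⟨q, y, T, hy, hT, hcy⟩ := (hpos.of_isConj hc).exists_represents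
  · have hS' : S = Finset.univ := Finset.eq_univ_of_card S (by simp [hS, hm])
    have hT' : T = Finset.univ := Finset.eq_univ_of_card T (by simp [hT, hm])
    subst hS' hT'
    obtain ⟨z, hz, hzx, hzy, -⟩ := hx.exists_commute_commute hy
    obtain ⟨z', hz', hneg, hcomm⟩ := hz.exists_neg
    obtain ⟨g, hg⟩ := AffineWeylC.exists_represents p hz
    obtain ⟨g', hg'⟩ := AffineWeylC.exists_represents q hz'
    have e0 : (commGraph (AffineWeylC.conjClass a)).edist ⟨b, hb⟩ ⟨b, hb⟩ ≤ 0 := by simp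
    have e1 := commGraph_edist_le_add_one (w := ⟨g, hmem hz hS hg⟩) e0 (hbx.commute hg hzx.symm)
    have e2 := commGraph_edist_le_add_one (w := ⟨g', hmem hz' hS hg'⟩) e1
      (hg.commute_neg hg' hz hz' hneg)
    have e3 := commGraph_edist_le_add_one (w := ⟨c, hc⟩) e2 (hg'.commute hcy (hcomm _ _ hy hzy))
    exact e3
  · obtain ⟨z₁, z₂, z₃, T₁, T₂, T₃, ⟨h₁, hT₁⟩, ⟨h₂, hT₂⟩, ⟨h₃, hT₃⟩, hz₁, hz₂, hz₃, hzy⟩ :=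
      hx.hasChain (by simpa using h5) hy (hT.trans hS.symm) (by rw [Fintype.card_fin]; omega)
    rw [hS] at hT₁ hT₂ hT₃
    obtain ⟨z', hz', hneg, hcomm⟩ := h₂.exists_neg
    obtain ⟨g₁, hg₁⟩ := AffineWeylC.exists_represents p h₁
    obtain ⟨g₂, hg₂⟩ := AffineWeylC.exists_represents p h₂
    obtain ⟨g', hg'⟩ := AffineWeylC.exists_represents q hz'
    obtain ⟨g₃, hg₃⟩ := AffineWeylC.exists_represents q h₃
    have e0 : (commGraph (AffineWeylC.conjClass a)).edist ⟨b, hb⟩ ⟨b, hb⟩ ≤ 0 := by simp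
    have e1 := commGraph_edist_le_add_one (w := ⟨g₁, hmem h₁ hT₁ hg₁⟩) e0
      (hbx.commute hg₁ hz₁.symm)
    have e2 := commGraph_edist_le_add_one (w := ⟨g₂, hmem h₂ hT₂ hg₂⟩) e1
      (hg₁.commute hg₂ hz₂.symm)
    have e3 := commGraph_edist_le_add_one (w := ⟨g', hmem hz' hT₂ hg'⟩) e2
      (hg₂.commute_neg hg' h₂ hz' hneg)
    have e4 := commGraph_edist_le_add_one (w := ⟨g₃, hmem h₃ hT₃ hg₃⟩) e3
      (hg'.commute hg₃ (hcomm _ _ h₃ hz₃))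
    have e5 := commGraph_edist_le_add_one (w := ⟨c, hc⟩) e4 (hg₃.commute hcy hzy)
    exact e5
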